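/- For every integer n ≥ 2, the expected sum of internal angles at the vertices of a simplex whose n vertices are i.i.d. with the beta density f_{n−1,−1/2} on ℝ^{n−1} satisfies 𝐉_{n,1}(−1/2) = n(n−1)² / (2^{n}·π^{(n−2)/2}) · (Γ(n/2)/Γ((n+1)/2))^{n−1} · Γ((n−1)²/2)/Γ(((n−1)²+1)/2). -/

import Mathlib

open MeasureTheory Real

noncomputable section

/-- The uniform probability measure on the unit sphere of `ℝ^m`. -/
def sphereUnif (m : ℕ) : Measure (Metric.sphere (0 : EuclideanSpace ℝ (Fin m)) 1) :=
  ((volume : Measure (EuclideanSpace ℝ (Fin m))).toSphere Set.univ)⁻¹ •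
    (volume : Measure (EuclideanSpace ℝ (Fin m))).toSphere

/-- The internal angle of a set `P ⊆ ℝ^m` at a reference point `g₀` (a point in the
relative interior of the face of interest): the normalized spherical Lebesgue measure of
the set of directions `u` on the unit sphere with `g₀ + ε • u ∈ P` for some `ε > 0`. -/
def internalAngle {m : ℕ} (g₀ : EuclideanSpace ℝ (Fin m))
    (P : Set (EuclideanSpace ℝ (Fin m))) : ℝ :=
  (sphereUnif m {u : Metric.sphere (0 : EuclideanSpace ℝ (Fin m)) 1 |
    ∃ ε : ℝ, 0 < ε ∧ g₀ + ε • (u : EuclideanSpace ℝ (Fin m)) ∈ P}).toReal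

/-- The beta density `f_{d,β}` on `ℝ^d`. -/
def betaDensity (d : ℕ) (β : ℝ) (x : EuclideanSpace ℝ (Fin d)) : ℝ :=
  (Real.Gamma ((d : ℝ) / 2 + β + 1) / (Real.pi ^ ((d : ℝ) / 2) * Real.Gamma (β + 1))) *
    (if ‖x‖ < 1 then (1 - ‖x‖ ^ 2) ^ β else 0)

/-- The beta distribution on `ℝ^d` with parameter `β > -1`; for `β = -1` it is
interpreted as the uniform distribution on the unit sphere `S^{d-1}`. -/
def betaMeasure (d : ℕ) (β : ℝ) : Measure (EuclideanSpace ℝ (Fin d)) :=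
  if β = -1 then
    Measure.map
      (fun u : Metric.sphere (0 : EuclideanSpace ℝ (Fin d)) 1 => (u : EuclideanSpace ℝ (Fin d)))
      (sphereUnif d)
  else
    volume.withDensity fun x => ENNReal.ofReal (betaDensity d β x)

/-- `J n k β`: the expected internal angle of the beta simplex `[X_1,…,X_n]` at its face
`[X_1,…,X_k]`, where `X_1,…,X_n` are i.i.d. points in `ℝ^(n-1)` with beta density
`f_{n-1,β}`. The reference point in the relative interior of the face is its centroid. -/
def J (n k : ℕ) (β : ℝ) : ℝ :=
  ∫ X : Fin n → EuclideanSpace ℝ (Fin (n - 1)),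
    internalAngle
      ((k : ℝ)⁻¹ • ∑ i ∈ Finset.univ.filter (fun i : Fin n => (i : ℕ) < k), X i)
      (convexHull ℝ (Set.range X))
    ∂(Measure.pi fun _ : Fin n => betaMeasure (n - 1) β)

/-- `Jb n k β = binom(n,k) * J n k β`, the expected internal angle sum `𝐉_{n,k}(β)`. -/
def Jb (n k : ℕ) (β : ℝ) : ℝ := (n.choose k : ℝ) * J n k β

section RandomSimplices

open scoped ENNReal Matrix

/-- Affine change of variables for the Lebesgue integral. -/
theorem lintegral_comp_linearMap_add {E : Type*} [NormedAddCommGroup E] [NormedSpace ℝ E]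
    [FiniteDimensional ℝ E] [MeasurableSpace E] [BorelSpace E] (μ : Measure E)
    [μ.IsAddHaarMeasure] (T : E →ₗ[ℝ] E) (hT : LinearMap.det T ≠ 0) (v : E) (g : E → ℝ≥0∞) :
    ∫⁻ x, g x ∂μ = ENNReal.ofReal |LinearMap.det T| * ∫⁻ x, g (T x + v) ∂μ := by
  have hinj : Function.Injective T := (LinearMap.equivOfDetNeZero T hT).injective
  have hsurj : Function.Surjective T := LinearMap.injective_iff_surjective.1 hinj
  have himg : (fun x => T x + v) '' Set.univ = Set.univ := by
    rw [Set.image_univ, Set.range_eq_univ]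
    intro y
    obtain ⟨x, hx⟩ := hsurj (y - v)
    exact ⟨x, by simp [hx]⟩
  have h := lintegral_image_eq_lintegral_abs_det_fderiv_mul μ (s := Set.univ)
    (f := fun x => T x + v) (f' := fun _ => LinearMap.toContinuousLinearMap T)
    MeasurableSet.univ
    (fun x _ => ((LinearMap.toContinuousLinearMap T).hasFDerivAt.add_const v).hasFDerivWithinAt)
    (fun x _ y _ hxy => hinj (by simpa using hxy)) g
  rw [himg] at h
  simp only [Measure.restrict_univ] at h
  rw [h, ← lintegral_const_mul' _ _ ENNReal.ofReal_ne_top]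
  rfl

theorem piFinSuccAbove_zero_symm_apply {m : ℕ} {α : Type*} [MeasurableSpace α] (x : α)
    (z : Fin m → α) :
    (MeasurableEquiv.piFinSuccAbove (fun _ : Fin (m + 1) => α) 0).symm (x, z) = Fin.cons x z := by
  simp [MeasurableEquiv.piFinSuccAbove, Fin.insertNthEquiv]

theorem lintegral_pi_cons {m : ℕ} {α : Type*} [MeasurableSpace α] (μ : Measure α) [SigmaFinite μ]
    {g : (Fin (m + 1) → α) → ℝ≥0∞} (hg : Measurable g) :
    ∫⁻ y, g y ∂(Measure.pi fun _ => μ) =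
      ∫⁻ x, ∫⁻ z, g (Fin.cons x z : Fin (m + 1) → α) ∂(Measure.pi fun _ : Fin m => μ) ∂μ := by
  have h := (measurePreserving_piFinSuccAbove (fun _ : Fin (m + 1) => μ) 0).symm
  rw [← h.lintegral_comp hg, lintegral_prod]
  · simp only [piFinSuccAbove_zero_symm_apply]
  · exact (hg.comp h.measurable).aemeasurable

theorem lintegral_real_cons {m : ℕ} {g : (Fin (m + 1) → ℝ) → ℝ≥0∞} (hg : Measurable g) :
    ∫⁻ y, g y = ∫⁻ x : ℝ, ∫⁻ z : Fin m → ℝ, g (Fin.cons x z : Fin (m + 1) → ℝ) :=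
  lintegral_pi_cons volume hg

theorem measurable_finCons {m : ℕ} {α : Type*} [MeasurableSpace α] :
    Measurable fun p : α × (Fin m → α) => (Fin.cons p.1 p.2 : Fin (m + 1) → α) := by
  refine measurable_pi_iff.2 fun i => ?_
  refine Fin.cases ?_ (fun j => ?_) i
  · simpa using measurable_fst
  · simp only [Fin.cons_succ]
    fun_prop

@[fun_prop]
theorem Measurable.finCons {m : ℕ} {α β : Type*} [MeasurableSpace α] [MeasurableSpace β]
    {f : β → α} {g : β → Fin m → α} (hf : Measurable f) (hg : Measurable g) :
    Measurable fun p => (Fin.cons (f p) (g p) : Fin (m + 1) → α) :=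
  measurable_finCons.comp (hf.prodMk hg)

theorem lintegral_columns {k m : ℕ} {g : (Fin k → Fin (m + 1) → ℝ) → ℝ≥0∞} (hg : Measurable g) :
    ∫⁻ y, g y = ∫⁻ z : Fin k → Fin m → ℝ, ∫⁻ x : Fin k → ℝ,
      g (fun i => (Fin.cons (x i) (z i) : Fin (m + 1) → ℝ)) := by
  have h1 := volume_preserving_pi (ι := Fin k) (fun _ =>
    (volume_preserving_piFinSuccAbove (fun _ : Fin (m + 1) => ℝ) 0).symm)
  have h2 := (volume_measurePreserving_arrowProdEquivProdArrow ℝ (Fin m → ℝ) (Fin k)).symm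
  have h := h1.comp h2
  rw [← h.lintegral_comp hg, Measure.volume_eq_prod, lintegral_prod_symm]
  · simp [MeasurableEquiv.arrowProdEquivProdArrow, Equiv.arrowProdEquivProdArrow]
    rfl
  · exact (hg.comp h.measurable).aemeasurable

section GeneralPosition

/-- Projections of closed sets in σ-compact spaces are measurable. -/
theorem IsClosed.measurableSet_image_of_continuous {X Y : Type*} [TopologicalSpace X]
    [SigmaCompactSpace X] [TopologicalSpace Y] [T2Space Y] [MeasurableSpace Y]
    [OpensMeasurableSpace Y] {C : Set X} (hC : IsClosed C) {f : X → Y} (hf : Continuous f) :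
    MeasurableSet (f '' C) := by
  have hCs : IsSigmaCompact C := isSigmaCompact_univ.of_isClosed_subset hC (Set.subset_univ C)
  obtain ⟨K, hK, hKu⟩ := hCs.image hf
  rw [← hKu]
  exact MeasurableSet.iUnion fun n => (hK n).isClosed.measurableSet

variable {E : Type*} [NormedAddCommGroup E] [NormedSpace ℝ E] [FiniteDimensional ℝ E]
  [MeasureSpace E] [BorelSpace E]

theorem measurableSet_exists_affine_combination (k : ℕ) :
    MeasurableSet {p : E × (Fin k → E) | ∃ t : Fin k → ℝ, ∑ i, t i = 1 ∧
      ∑ i, t i • p.2 i = p.1} := by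
  have hC : IsClosed {q : (E × (Fin k → E)) × (Fin k → ℝ) | ∑ i, q.2 i = 1 ∧
      ∑ i, q.2 i • q.1.2 i = q.1.1} :=
    (isClosed_eq (by fun_prop) (by fun_prop)).inter (isClosed_eq (by fun_prop) (by fun_prop))
  convert hC.measurableSet_image_of_continuous continuous_fst using 1
  ext p
  simp

variable [(volume : Measure E).IsAddHaarMeasure]

theorem volume_affine_combinations_eq_zero {k : ℕ} (hk : k ≤ Module.finrank ℝ E)
    (z : Fin k → E) :
    volume {x : E | ∃ t : Fin k → ℝ, ∑ i, t i = 1 ∧ ∑ i, t i • z i = x} = 0 := by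
  obtain _ | k := k
  · simp
  refine measure_mono_null (t := affineSpan ℝ (Set.range z)) ?_
    (Measure.addHaar_affineSubspace _ _ ?_)
  · rintro x ⟨t, ht, rfl⟩
    rw [← Finset.affineCombination_eq_linear_combination _ _ _ ht]
    exact affineCombination_mem_affineSpan ht z
  · intro htop
    have h1 := finrank_vectorSpan_range_le ℝ z (n := k) (by simp)
    rw [← direction_affineSpan, htop, AffineSubspace.direction_top, finrank_top] at h1
    omega

/-- Almost surely, a random point is not an affine combination of at most `dim E` others. -/
theorem ae_head_ne_affine_combination (μ : Measure E) [SigmaFinite μ] (hμ : μ ≪ volume) {k : ℕ}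
    (hk : k ≤ Module.finrank ℝ E) :
    ∀ᵐ z ∂(Measure.pi fun _ : Fin (k + 1) => μ), ∀ t : Fin k → ℝ, ∑ i, t i = 1 →
      ∑ i, t i • z i.succ ≠ z 0 := by
  have h := measurePreserving_piFinSuccAbove (fun _ : Fin (k + 1) => μ) 0
  have h2 : ∀ᵐ p ∂(μ.prod (Measure.pi fun _ : Fin k => μ)), ∀ t : Fin k → ℝ, ∑ i, t i = 1 →
      ∑ i, t i • p.2 i ≠ p.1 := by
    have hm := (measurableSet_exists_affine_combination (E := E) k).compl
    have hs : {p : E × (Fin k → E) | ∀ t : Fin k → ℝ, ∑ i, t i = 1 → ∑ i, t i • p.2 i ≠ p.1} =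
        {p : E × (Fin k → E) | ∃ t : Fin k → ℝ, ∑ i, t i = 1 ∧ ∑ i, t i • p.2 i = p.1}ᶜ := by
      ext p; simp
    rw [← hs] at hm
    rw [Measure.ae_prod_iff_ae_ae hm, Measure.ae_ae_comm hm]
    refine Filter.Eventually.of_forall fun z => hμ.ae_le ?_
    change volume _ = 0
    convert volume_affine_combinations_eq_zero hk z using 2
    ext x
    simp
  filter_upwards [h.quasiMeasurePreserving.ae h2] with z hz t ht
  simpa [MeasurableEquiv.piFinSuccAbove, Fin.insertNthEquiv, Fin.tail] using! hz t ht

theorem ae_eq_zero_of_sum_smul_eq_zero {k : ℕ} (hk : k ≤ Module.finrank ℝ E + 1) :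
    ∀ᵐ z : Fin k → E, ∀ w : Fin k → ℝ, ∑ i, w i = 0 → ∑ i, w i • z i = 0 → w = 0 := by
  induction k with
  | zero => exact Filter.Eventually.of_forall fun z w _ _ => Subsingleton.elim _ _
  | succ k ih =>
    have h := volume_preserving_piFinSuccAbove (fun _ : Fin (k + 1) => E) 0
    have h2 := h.quasiMeasurePreserving.ae (Measure.quasiMeasurePreserving_snd.ae (ih (by omega)))
    filter_upwards [ae_head_ne_affine_combination (volume : Measure E)
      Measure.AbsolutelyContinuous.rfl (k := k) (by omega), h2] with z hz hz2 w hw hwz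
    replace hz2 : ∀ w : Fin k → ℝ, ∑ i, w i = 0 → ∑ i, w i • z i.succ = 0 → w = 0 := by
      simpa [MeasurableEquiv.piFinSuccAbove, Fin.insertNthEquiv, Fin.tail] using! hz2
    rw [Fin.sum_univ_succ] at hw hwz
    by_cases h0 : w 0 = 0
    · have := hz2 (fun i => w i.succ) (by simpa [h0] using hw) (by simpa [h0] using hwz)
      ext i
      refine Fin.cases h0 (fun j => congrFun this j) i
    · exfalso
      refine hz (fun i => -(w 0)⁻¹ * w i.succ) ?_ ?_
      · rw [← Finset.mul_sum, eq_neg_of_add_eq_zero_right hw]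
        field_simp
      · simp_rw [mul_smul]
        rw [← Finset.smul_sum, eq_neg_of_add_eq_zero_right hwz, smul_neg, neg_smul, neg_neg,
          smul_smul, inv_mul_cancel₀ h0, one_smul]

/-- The matrix with rows `(1, z i)`. -/
def homMatrix {m : ℕ} (z : Fin (m + 1) → Fin m → ℝ) : Matrix (Fin (m + 1)) (Fin (m + 1)) ℝ :=
  Matrix.of fun i => Fin.cons 1 (z i)

theorem measurable_det_homMatrix {m : ℕ} :
    Measurable fun z : Fin (m + 1) → Fin m → ℝ => (homMatrix z).det := by
  have h (i j : Fin (m + 1)) : Measurable fun z : Fin (m + 1) → Fin m → ℝ => homMatrix z i j :=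
    (measurable_pi_apply j).comp (measurable_const.finCons (measurable_pi_apply i))
  simp only [Matrix.det_apply']
  fun_prop

theorem homMatrix_vecMul {m : ℕ} (z : Fin (m + 1) → Fin m → ℝ) (w : Fin (m + 1) → ℝ) :
    w ᵥ* homMatrix z = Fin.cons (∑ i, w i) (∑ i, w i • z i) := by
  ext j
  refine Fin.cases ?_ (fun j => ?_) j
  · simp [homMatrix, Matrix.vecMul, dotProduct]
  · simp [homMatrix, Matrix.vecMul, dotProduct]

theorem ae_det_homMatrix_ne_zero (m : ℕ) :
    ∀ᵐ z : Fin (m + 1) → Fin m → ℝ, (homMatrix z).det ≠ 0 := by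
  filter_upwards [ae_eq_zero_of_sum_smul_eq_zero (E := Fin m → ℝ) (k := m + 1) (by simp)]
    with z hz hdet
  obtain ⟨w, hw, hw0⟩ := Matrix.exists_vecMul_eq_zero_iff.2 hdet
  rw [homMatrix_vecMul] at hw0
  refine hw (hz w ?_ ?_)
  · simpa using congrFun hw0 0
  · ext j
    simpa using congrFun hw0 j.succ

end GeneralPosition

/-- The volume of the Euclidean unit ball of `ℝ^m`. -/
def ballVol (m : ℕ) : ℝ≥0∞ := volume {z : Fin m → ℝ | z ⬝ᵥ z < 1}

theorem measurableSet_dotProduct_lt (m : ℕ) (r : ℝ) :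
    MeasurableSet {z : Fin m → ℝ | z ⬝ᵥ z < r} :=
  (isOpen_lt (by fun_prop) continuous_const).measurableSet

theorem dotProduct_self_nonneg' {m : ℕ} (z : Fin m → ℝ) : 0 ≤ z ⬝ᵥ z :=
  Finset.sum_nonneg fun i _ => mul_self_nonneg (z i)

theorem cons_dotProduct_self {m : ℕ} (x : ℝ) (z : Fin m → ℝ) :
    (Fin.cons x z : Fin (m + 1) → ℝ) ⬝ᵥ Fin.cons x z = x ^ 2 + z ⬝ᵥ z := by
  simp [dotProduct, Fin.sum_univ_succ, sq]

theorem norm_toLp_sq {m : ℕ} (z : Fin m → ℝ) :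
    ‖(WithLp.toLp 2 z : EuclideanSpace ℝ (Fin m))‖ ^ 2 = z ⬝ᵥ z := by
  rw [EuclideanSpace.norm_sq_eq]
  simp [dotProduct, sq]

theorem ballVol_eq (m : ℕ) :
    ballVol m = ENNReal.ofReal (√π ^ m / Gamma ((m : ℝ) / 2 + 1)) := by
  obtain _ | m := m
  · have : {z : Fin 0 → ℝ | z ⬝ᵥ z < 1} = Set.univ := by ext; simp
    rw [ballVol, this, volume_pi, Measure.pi_univ]
    simp
  · have h := EuclideanSpace.volume_ball (Fin (m + 1)) 0 1
    rw [← (PiLp.volume_preserving_toLp (Fin (m + 1))).measure_preimage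
      measurableSet_ball.nullMeasurableSet] at h
    convert h using 1
    · rw [ballVol]
      congr 1
      ext z
      simp only [Set.mem_ofPred_eq, Set.mem_preimage, mem_ball_zero_iff]
      rw [← norm_toLp_sq, sq_lt_one_iff₀ (norm_nonneg _)]
    · simp

theorem ballVol_ne_zero (m : ℕ) : ballVol m ≠ 0 := by
  rw [ballVol_eq, Ne, ENNReal.ofReal_eq_zero, not_le]
  have : 0 < Gamma ((m : ℝ) / 2 + 1) := Gamma_pos_of_pos (by positivity)
  positivity

theorem ballVol_ne_top (m : ℕ) : ballVol m ≠ ∞ := by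
  rw [ballVol_eq]; exact ENNReal.ofReal_ne_top

theorem volume_dotProduct_lt (m : ℕ) {r : ℝ} (hr : 0 < r) :
    volume {z : Fin m → ℝ | z ⬝ᵥ z < r} = ENNReal.ofReal (√r ^ m) * ballVol m := by
  have h := Measure.addHaar_smul (volume : Measure (Fin m → ℝ)) (√r) {z | z ⬝ᵥ z < 1}
  have h0 : √r ≠ 0 := (sqrt_pos.2 hr).ne'
  rw [Module.finrank_fin_fun, abs_of_nonneg (by positivity)] at h
  rw [ballVol, ← h]
  congr 1
  ext z
  rw [Set.mem_smul_set_iff_inv_smul_mem₀ h0]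
  simp only [Set.mem_ofPred_eq, smul_dotProduct, dotProduct_smul, smul_eq_mul]
  rw [← mul_assoc, ← mul_inv, mul_self_sqrt hr.le, inv_mul_lt_one₀ hr]

theorem lintegral_real_scale (g : ℝ → ℝ≥0∞) {a : ℝ} (ha : 0 < a) :
    ∫⁻ x, g x = ENNReal.ofReal a * ∫⁻ x, g (a * x) := by
  have h := lintegral_comp_linearMap_add (volume : Measure ℝ) (a • LinearMap.id) (by simp [ha.ne'])
    0 g
  simpa [abs_of_pos ha] using h

theorem lintegral_pi_smul {m : ℕ} (g : (Fin m → ℝ) → ℝ≥0∞) {a : ℝ} (ha : a ≠ 0) :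
    ∫⁻ x, g x = ENNReal.ofReal (|a| ^ m) * ∫⁻ x, g (a • x) := by
  have h := lintegral_comp_linearMap_add (volume : Measure (Fin m → ℝ)) (a • LinearMap.id)
    (by simp [ha]) 0 g
  simpa using h

theorem ballVol_succ (m : ℕ) :
    ballVol (m + 1) = ballVol m * ∫⁻ h in Set.Ioo (-1 : ℝ) 1, ENNReal.ofReal (√(1 - h ^ 2) ^ m) := by
  rw [ballVol, ← lintegral_indicator_one (measurableSet_dotProduct_lt _ _),
    lintegral_real_cons (measurable_one.indicator (measurableSet_dotProduct_lt _ _)),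
    ← lintegral_const_mul' _ _ (ballVol_ne_top m), ← lintegral_indicator measurableSet_Ioo]
  refine lintegral_congr fun x => ?_
  have : (fun z : Fin m → ℝ => Set.indicator {z : Fin (m + 1) → ℝ | z ⬝ᵥ z < 1}
      (1 : (Fin (m + 1) → ℝ) → ℝ≥0∞) (Fin.cons x z)) =
      Set.indicator {z | z ⬝ᵥ z < 1 - x ^ 2} 1 := by
    ext z
    simp [Set.indicator, cons_dotProduct_self, lt_sub_iff_add_lt, add_comm]
  rw [this, lintegral_indicator_one (measurableSet_dotProduct_lt _ _)]
  by_cases hx : x ∈ Set.Ioo (-1 : ℝ) 1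
  · rw [Set.indicator_of_mem hx, volume_dotProduct_lt, mul_comm]
    nlinarith [hx.1, hx.2]
  · rw [Set.indicator_of_notMem hx]
    refine (congrArg volume (Set.eq_empty_of_forall_notMem fun z => ?_)).trans measure_empty
    simp only [Set.mem_ofPred_eq, not_lt]
    have : 1 ≤ x ^ 2 := by
      by_contra! h
      exact hx (abs_lt.1 ((sq_lt_one_iff_abs_lt_one x).1 h))
    linarith [dotProduct_self_nonneg' z]

theorem lintegral_abs_pow (m : ℕ) :
    ∫⁻ x in Set.Ioo (-1 : ℝ) 1, ENNReal.ofReal (|x| ^ m) = ENNReal.ofReal (2 / (m + 1)) := by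
  have hc : Continuous fun x : ℝ => |x| ^ m := by fun_prop
  rw [restrict_Ioo_eq_restrict_Ioc, ← ofReal_integral_eq_lintegral_ofReal
    (hc.integrableOn_Ioc) (Filter.Eventually.of_forall fun x => by positivity),
    ← intervalIntegral.integral_of_le (by norm_num),
    ← intervalIntegral.integral_add_adjacent_intervals (b := 0) (hc.intervalIntegrable _ _)
      (hc.intervalIntegrable _ _)]
  have h1 : ∫ x in (0 : ℝ)..1, |x| ^ m = 1 / (m + 1) := by
    rw [intervalIntegral.integral_congr (g := fun x => x ^ m)]
    · simp
    · intro x hx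
      rw [Set.uIcc_of_le zero_le_one] at hx
      simp [abs_of_nonneg hx.1]
  have h2 : ∫ x in (-1 : ℝ)..0, |x| ^ m = 1 / (m + 1) := by
    rw [← h1]
    have := intervalIntegral.integral_comp_neg (a := (0 : ℝ)) (b := 1) fun x => |x| ^ m
    simpa using this.symm
  rw [h1, h2]
  congr 1
  ring

theorem ballVol_succ_eq_cauchy (m : ℕ) :
    ballVol (m + 1) = ENNReal.ofReal (2 / (m + 1)) *
      ∫⁻ c : Fin m → ℝ, ENNReal.ofReal ((√(1 + c ⬝ᵥ c))⁻¹ ^ (m + 1)) := by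
  have hmeas : Measurable fun p : ℝ × (Fin m → ℝ) =>
      ENNReal.ofReal (|p.1| ^ m) * Set.indicator {p : ℝ × (Fin m → ℝ) |
        p.1 ^ 2 * (1 + p.2 ⬝ᵥ p.2) < 1} 1 p :=
    Measurable.mul (by fun_prop) (measurable_one.indicator
      (isOpen_lt (by fun_prop) continuous_const).measurableSet)
  calc ballVol (m + 1) = ∫⁻ x : ℝ, ∫⁻ c : Fin m → ℝ, ENNReal.ofReal (|x| ^ m) *
        Set.indicator {p : ℝ × (Fin m → ℝ) | p.1 ^ 2 * (1 + p.2 ⬝ᵥ p.2) < 1} 1 (x, c) := by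
        rw [ballVol, ← lintegral_indicator_one (measurableSet_dotProduct_lt _ _),
          lintegral_real_cons (measurable_one.indicator (measurableSet_dotProduct_lt _ _))]
        refine lintegral_congr_ae ?_
        filter_upwards [Measure.ae_ne volume (0 : ℝ)] with x hx
        rw [lintegral_pi_smul _ hx, lintegral_const_mul' _ _ ENNReal.ofReal_ne_top]
        congr 1
        refine lintegral_congr fun c => ?_
        simp only [Set.indicator, Set.mem_ofPred_eq, cons_dotProduct_self, smul_dotProduct,
          dotProduct_smul, smul_eq_mul, Pi.one_apply]
        congr 2
        ring
    _ = ∫⁻ c : Fin m → ℝ, ∫⁻ x : ℝ, ENNReal.ofReal (|x| ^ m) *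
        Set.indicator {p : ℝ × (Fin m → ℝ) | p.1 ^ 2 * (1 + p.2 ⬝ᵥ p.2) < 1} 1 (x, c) :=
        lintegral_lintegral_swap hmeas.aemeasurable
    _ = _ := by
        rw [← lintegral_const_mul' _ _ ENNReal.ofReal_ne_top]
        refine lintegral_congr fun c => ?_
        have hq : 0 < 1 + c ⬝ᵥ c := by linarith [dotProduct_self_nonneg' c]
        have ha : 0 < (√(1 + c ⬝ᵥ c))⁻¹ := inv_pos.2 (sqrt_pos.2 hq)
        rw [lintegral_real_scale _ ha, ← lintegral_abs_pow, ← lintegral_indicator measurableSet_Ioo,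
          mul_comm (lintegral _ _), pow_succ', ENNReal.ofReal_mul ha.le, mul_assoc]
        congr 1
        rw [← lintegral_const_mul' _ _ ENNReal.ofReal_ne_top]
        refine lintegral_congr fun x => ?_
        have hiff : ((√(1 + c ⬝ᵥ c))⁻¹ * x, c) ∈ {p : ℝ × (Fin m → ℝ) |
            p.1 ^ 2 * (1 + p.2 ⬝ᵥ p.2) < 1} ↔ x ∈ Set.Ioo (-1 : ℝ) 1 := by
          rw [Set.mem_ofPred_eq, mul_pow, inv_pow, sq_sqrt hq.le, mul_right_comm, inv_mul_cancel₀ hq.ne', one_mul,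
            sq_lt_one_iff_abs_lt_one, abs_lt]
          rfl
        by_cases hx : x ∈ Set.Ioo (-1 : ℝ) 1
        · rw [Set.indicator_of_mem hx, Set.indicator_of_mem (hiff.2 hx), abs_mul, mul_pow,
            abs_of_pos ha, ENNReal.ofReal_mul (pow_nonneg ha.le m), Pi.one_apply, mul_one]
        · rw [Set.indicator_of_notMem hx, Set.indicator_of_notMem (mt hiff.1 hx), mul_zero, mul_zero]

theorem det_homMatrix_affine {m : ℕ} (B : Matrix (Fin m) (Fin m) ℝ) (v : Fin m → ℝ)
    (w : Fin (m + 1) → Fin m → ℝ) :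
    (homMatrix fun i => B *ᵥ w i + v).det = B.det * (homMatrix w).det := by
  let N : Matrix (Fin (m + 1)) (Fin (m + 1)) ℝ :=
    Matrix.of (Fin.cons (Fin.cons 1 v) fun j => Fin.cons 0 (Bᵀ j))
  have hN : N.det = B.det := by
    rw [Matrix.det_succ_column_zero, Fin.sum_univ_succ, Finset.sum_eq_zero]
    · have : N.submatrix (Fin.succAbove 0) Fin.succ = Bᵀ := by
        ext i j
        simp [N]
      rw [this]
      simp [N]
    · intro i _
      simp [N]
  have hmul : (homMatrix fun i => B *ᵥ w i + v) = homMatrix w * N := by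
    ext i k
    refine Fin.cases ?_ (fun k => ?_) k
    · simp [homMatrix, N, Matrix.mul_apply, Fin.sum_univ_succ]
    · simp [homMatrix, N, Matrix.mul_apply, Fin.sum_univ_succ, Matrix.mulVec, dotProduct, add_comm,
        mul_comm]
  rw [hmul, Matrix.det_mul, hN, mul_comm]

/-- The linear part of the affine map from the unit ball onto the ellipsoid
`z ⬝ᵥ z + (b + z ⬝ᵥ c)² < 1`. -/
def ellipsoidMatrix {m : ℕ} (c : Fin m → ℝ) (r : ℝ) : Matrix (Fin m) (Fin m) ℝ :=
  r • (1 - (√(1 + c ⬝ᵥ c) * (1 + √(1 + c ⬝ᵥ c)))⁻¹ • Matrix.vecMulVec c c)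

theorem sqrt_one_add_dotProduct_pos {m : ℕ} (c : Fin m → ℝ) : 0 < √(1 + c ⬝ᵥ c) :=
  sqrt_pos.2 (by linarith [dotProduct_self_nonneg' c])

theorem sq_sqrt_one_add_dotProduct {m : ℕ} (c : Fin m → ℝ) :
    √(1 + c ⬝ᵥ c) ^ 2 = 1 + c ⬝ᵥ c :=
  sq_sqrt (by linarith [dotProduct_self_nonneg' c])

theorem det_ellipsoidMatrix {m : ℕ} (c : Fin m → ℝ) (r : ℝ) :
    (ellipsoidMatrix c r).det = r ^ m * (√(1 + c ⬝ᵥ c))⁻¹ := by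
  have hq := sqrt_one_add_dotProduct_pos c
  have hq2 := sq_sqrt_one_add_dotProduct c
  rw [ellipsoidMatrix, Matrix.det_smul, Fintype.card_fin, sub_eq_add_neg, ← neg_smul,
    ← Matrix.smul_vecMulVec, Matrix.vecMulVec_eq Unit,
    Matrix.det_one_add_replicateCol_mul_replicateRow, dotProduct_smul, smul_eq_mul]
  congr 1
  have hcc : c ⬝ᵥ c = √(1 + c ⬝ᵥ c) ^ 2 - 1 := by rw [hq2]; ring
  generalize √(1 + c ⬝ᵥ c) = q at *
  rw [hcc]
  field_simp
  ring

theorem ellipsoid_identity {m : ℕ} (c w : Fin m → ℝ) (r h : ℝ) (hr : r ^ 2 = 1 - h ^ 2)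
    (z : Fin m → ℝ) (hz : z = ellipsoidMatrix c r *ᵥ w + (-(h / √(1 + c ⬝ᵥ c))) • c) :
    z ⬝ᵥ z + (√(1 + c ⬝ᵥ c) * h + z ⬝ᵥ c) ^ 2 = 1 - r ^ 2 * (1 - w ⬝ᵥ w) := by
  have hq := sqrt_one_add_dotProduct_pos c
  have hq2 := sq_sqrt_one_add_dotProduct c
  have hmul : ellipsoidMatrix c r *ᵥ w = r • (w - ((√(1 + c ⬝ᵥ c) * (1 + √(1 + c ⬝ᵥ c)))⁻¹ *
      (c ⬝ᵥ w)) • c) := by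
    rw [ellipsoidMatrix, Matrix.smul_mulVec, Matrix.sub_mulVec, Matrix.one_mulVec,
      Matrix.smul_mulVec, Matrix.vecMulVec_mulVec, mul_smul]
    simp
  rw [hz, hmul]
  simp only [add_dotProduct, dotProduct_add, smul_dotProduct, dotProduct_smul, sub_dotProduct,
    dotProduct_sub, smul_eq_mul, dotProduct_comm w c]
  have hcc : c ⬝ᵥ c = √(1 + c ⬝ᵥ c) ^ 2 - 1 := by rw [hq2]; ring
  generalize √(1 + c ⬝ᵥ c) = q at *
  rw [hcc]
  generalize c ⬝ᵥ w = y at *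
  generalize w ⬝ᵥ w = W at *
  have : 1 + q ≠ 0 := by positivity
  field_simp
  rw [hr]
  linear_combination (q ^ 2 * W + 2 * q ^ 3 * W + q ^ 4 * W) * hr

/-- The integral of `|det (1, z i)|` over all `(m + 1)`-tuples of points of the unit ball. -/
def simplexIntegral (m : ℕ) : ℝ≥0∞ :=
  ∫⁻ z : Fin (m + 1) → Fin m → ℝ,
    Set.indicator {z | ∀ i, z i ⬝ᵥ z i < 1} (fun z => ENNReal.ofReal |(homMatrix z).det|) z

theorem lintegral_ellipsoid {m : ℕ} (c : Fin m → ℝ) (h : ℝ) :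
    ∫⁻ z : Fin (m + 1) → Fin m → ℝ,
      Set.indicator {z | ∀ i, z i ⬝ᵥ z i + (√(1 + c ⬝ᵥ c) * h + z i ⬝ᵥ c) ^ 2 < 1}
        (fun z => ENNReal.ofReal |(homMatrix z).det|) z =
      Set.indicator (Set.Ioo (-1 : ℝ) 1) (fun h => ENNReal.ofReal (√(1 - h ^ 2) ^ (m * (m + 2)))) h *
        ENNReal.ofReal ((√(1 + c ⬝ᵥ c))⁻¹ ^ (m + 2)) * simplexIntegral m := by
  have hq := sqrt_one_add_dotProduct_pos c
  by_cases hh : h ∈ Set.Ioo (-1 : ℝ) 1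
  · have h1 : 0 < 1 - h ^ 2 := by nlinarith [hh.1, hh.2]
    set r := √(1 - h ^ 2) with hr
    have hr0 : 0 < r := sqrt_pos.2 h1
    have hr2 : r ^ 2 = 1 - h ^ 2 := sq_sqrt h1.le
    set B := ellipsoidMatrix c r
    set v : Fin m → ℝ := (-(h / √(1 + c ⬝ᵥ c))) • c with hv
    have hB : B.det = r ^ m * (√(1 + c ⬝ᵥ c))⁻¹ := det_ellipsoidMatrix c r
    have hB0 : 0 < B.det := by rw [hB]; positivity
    let T : (Fin (m + 1) → Fin m → ℝ) →ₗ[ℝ] (Fin (m + 1) → Fin m → ℝ) :=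
      LinearMap.pi fun i => (Matrix.toLin' B).comp (LinearMap.proj i)
    have hT : LinearMap.det T = B.det ^ (m + 1) := by
      rw [LinearMap.det_pi]
      simp
    rw [lintegral_comp_linearMap_add volume T (by rw [hT]; positivity) (fun _ => v),
      Set.indicator_of_mem hh, hT, abs_of_pos (by positivity)]
    have hint (w : Fin (m + 1) → Fin m → ℝ) :
        Set.indicator {z : Fin (m + 1) → Fin m → ℝ |
            ∀ i, z i ⬝ᵥ z i + (√(1 + c ⬝ᵥ c) * h + z i ⬝ᵥ c) ^ 2 < 1}
          (fun z => ENNReal.ofReal |(homMatrix z).det|) (T w + fun _ => v) =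
        ENNReal.ofReal B.det * Set.indicator {z | ∀ i, z i ⬝ᵥ z i < 1}
          (fun z => ENNReal.ofReal |(homMatrix z).det|) w := by
      have hTw : (T w + fun _ => v) = fun i => B *ᵥ w i + v := by
        ext i j; simp [T]
      have hiff : (T w + fun _ => v) ∈ {z : Fin (m + 1) → Fin m → ℝ |
            ∀ i, z i ⬝ᵥ z i + (√(1 + c ⬝ᵥ c) * h + z i ⬝ᵥ c) ^ 2 < 1} ↔
          w ∈ {z : Fin (m + 1) → Fin m → ℝ | ∀ i, z i ⬝ᵥ z i < 1} := by
        rw [hTw]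
        refine forall_congr' fun i => ?_
        rw [ellipsoid_identity c (w i) r h hr2 _ rfl, sub_lt_self_iff,
          mul_pos_iff_of_pos_left (by positivity), sub_pos]
      by_cases hw : w ∈ {z : Fin (m + 1) → Fin m → ℝ | ∀ i, z i ⬝ᵥ z i < 1}
      · rw [Set.indicator_of_mem hw, Set.indicator_of_mem (hiff.2 hw), hTw, det_homMatrix_affine,
          abs_mul, abs_of_pos hB0, ENNReal.ofReal_mul hB0.le]
      · rw [Set.indicator_of_notMem hw, Set.indicator_of_notMem (mt hiff.1 hw), mul_zero]
    simp_rw [hint]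
    rw [lintegral_const_mul' _ _ ENNReal.ofReal_ne_top, ← mul_assoc,
      ← ENNReal.ofReal_mul (by positivity), ← ENNReal.ofReal_mul (by positivity), simplexIntegral,
      hB]
    congr 2
    ring
  · rw [Set.indicator_of_notMem hh, zero_mul, zero_mul, lintegral_eq_zero_of_ae_eq_zero]
    refine Filter.Eventually.of_forall fun z => Set.indicator_of_notMem (fun hz => ?_) _
    have h1 : 1 ≤ h ^ 2 := by
      by_contra! hlt
      exact hh (abs_lt.1 ((sq_lt_one_iff_abs_lt_one h).1 hlt))
    have hz0 := hz 0
    have hq2 := sq_sqrt_one_add_dotProduct c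
    have hcs : (z 0 ⬝ᵥ c) ^ 2 ≤ (z 0 ⬝ᵥ z 0) * (c ⬝ᵥ c) := by
      simpa [dotProduct, sq] using
        Finset.sum_mul_sq_le_sq_mul_sq Finset.univ (z 0) c
    have hzz := dotProduct_self_nonneg' (z 0)
    have hcc := dotProduct_self_nonneg' c
    generalize √(1 + c ⬝ᵥ c) = q at *
    generalize z 0 ⬝ᵥ c = y at *
    generalize z 0 ⬝ᵥ z 0 = Z at *
    generalize c ⬝ᵥ c = C at *
    rcases hcc.eq_or_lt with rfl | hC
    · have hy : y = 0 := by nlinarith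
      subst hy
      nlinarith
    · have : C * (Z + (q * h + y) ^ 2 - h ^ 2) = (Z * C - y ^ 2) + (q * y + C * h) ^ 2 := by
        linear_combination (C * h ^ 2 - y ^ 2) * hq2
      nlinarith [sq_nonneg (q * y + C * h)]

/-- Disintegration of tuples of points along the hyperplanes they span. -/
theorem lintegral_hyperplane {m : ℕ} {F : (Fin (m + 1) → ℝ) → (Fin (m + 1) → Fin m → ℝ) → ℝ≥0∞}
    (hF : Measurable (Function.uncurry F)) :
    ∫⁻ z : Fin (m + 1) → Fin m → ℝ, ∫⁻ x : Fin (m + 1) → ℝ, F x z =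
      ∫⁻ c : Fin m → ℝ, ∫⁻ b : ℝ, ∫⁻ z : Fin (m + 1) → Fin m → ℝ,
        ENNReal.ofReal |(homMatrix z).det| * F (fun i => b + z i ⬝ᵥ c) z := by
  have hm (z : Fin (m + 1) → Fin m → ℝ) (b : ℝ) (c : Fin m → ℝ) :
      homMatrix z *ᵥ (Fin.cons b c : Fin (m + 1) → ℝ) = fun i => b + z i ⬝ᵥ c := by
    ext i
    simp [homMatrix, Matrix.mulVec, dotProduct, Fin.sum_univ_succ]
  have hent (i j : Fin (m + 1)) :
      Measurable fun z : Fin (m + 1) → Fin m → ℝ => homMatrix z i j :=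
    (measurable_pi_apply j).comp (measurable_const.finCons (measurable_pi_apply i))
  have hmv : Measurable fun p : (Fin (m + 1) → Fin m → ℝ) × (Fin (m + 1) → ℝ) =>
      homMatrix p.1 *ᵥ p.2 := by
    refine measurable_pi_iff.2 fun i => ?_
    simp only [Matrix.mulVec, dotProduct]
    fun_prop
  have hG : Measurable fun p : (Fin (m + 1) → Fin m → ℝ) × (Fin (m + 1) → ℝ) =>
      ENNReal.ofReal |(homMatrix p.1).det| * F (homMatrix p.1 *ᵥ p.2) p.1 := by
    refine Measurable.mul ?_ (hF.comp (hmv.prodMk measurable_fst))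
    exact ENNReal.measurable_ofReal.comp
      (continuous_abs.measurable.comp (measurable_det_homMatrix.comp measurable_fst))
  calc ∫⁻ z : Fin (m + 1) → Fin m → ℝ, ∫⁻ x : Fin (m + 1) → ℝ, F x z
      = ∫⁻ z : Fin (m + 1) → Fin m → ℝ, ∫⁻ a : Fin (m + 1) → ℝ,
        ENNReal.ofReal |(homMatrix z).det| * F (homMatrix z *ᵥ a) z := by
        refine lintegral_congr_ae ?_
        filter_upwards [ae_det_homMatrix_ne_zero m] with z hz
        rw [lintegral_comp_linearMap_add volume (Matrix.toLin' (homMatrix z)) (by simpa using hz) 0,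
          ← lintegral_const_mul' _ _ ENNReal.ofReal_ne_top]
        simp
    _ = ∫⁻ a : Fin (m + 1) → ℝ, ∫⁻ z : Fin (m + 1) → Fin m → ℝ,
        ENNReal.ofReal |(homMatrix z).det| * F (homMatrix z *ᵥ a) z :=
        lintegral_lintegral_swap hG.aemeasurable
    _ = _ := by
        have hG' : Measurable fun a : Fin (m + 1) → ℝ => ∫⁻ z : Fin (m + 1) → Fin m → ℝ,
            ENNReal.ofReal |(homMatrix z).det| * F (homMatrix z *ᵥ a) z :=
          hG.lintegral_prod_left'
        rw [lintegral_real_cons hG', lintegral_lintegral_swap]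
        · simp_rw [hm]
        · exact (hG'.comp measurable_finCons).aemeasurable

/-- Kingman's formula for the mean volume of a random simplex in a ball. -/
theorem ballVol_pow_eq (m : ℕ) :
    ballVol (m + 1) ^ (m + 1) =
      (∫⁻ h in Set.Ioo (-1 : ℝ) 1, ENNReal.ofReal (√(1 - h ^ 2) ^ (m * (m + 2)))) *
        (∫⁻ c : Fin m → ℝ, ENNReal.ofReal ((√(1 + c ⬝ᵥ c))⁻¹ ^ (m + 1))) * simplexIntegral m := by
  let F : (Fin (m + 1) → ℝ) → (Fin (m + 1) → Fin m → ℝ) → ℝ≥0∞ := fun x z =>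
    Set.indicator {p : (Fin (m + 1) → ℝ) × (Fin (m + 1) → Fin m → ℝ) |
      ∀ i, p.2 i ⬝ᵥ p.2 i + p.1 i ^ 2 < 1} 1 (x, z)
  have hset : MeasurableSet {p : (Fin (m + 1) → ℝ) × (Fin (m + 1) → Fin m → ℝ) |
      ∀ i, p.2 i ⬝ᵥ p.2 i + p.1 i ^ 2 < 1} := by
    rw [Set.ofPred_forall]
    exact MeasurableSet.iInter fun i => (isOpen_lt (by fun_prop) continuous_const).measurableSet
  have hF : Measurable (Function.uncurry F) := measurable_one.indicator hset
  have hpi : MeasurableSet {y : Fin (m + 1) → Fin (m + 1) → ℝ | ∀ i, y i ⬝ᵥ y i < 1} := by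
    rw [Set.ofPred_forall]
    exact MeasurableSet.iInter fun i => (isOpen_lt (by fun_prop) continuous_const).measurableSet
  have h1 : ballVol (m + 1) ^ (m + 1) =
      volume {y : Fin (m + 1) → Fin (m + 1) → ℝ | ∀ i, y i ⬝ᵥ y i < 1} := by
    have h := volume_pi_pi fun _ : Fin (m + 1) => {z : Fin (m + 1) → ℝ | z ⬝ᵥ z < 1}
    simp only [Finset.prod_const, Finset.card_univ, Fintype.card_fin] at h
    rw [ballVol, ← h]
    congr 1
    ext y
    simp
  rw [h1, ← lintegral_indicator_one hpi, lintegral_columns (measurable_one.indicator hpi)]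
  have h2 (z : Fin (m + 1) → Fin m → ℝ) (x : Fin (m + 1) → ℝ) :
      Set.indicator {y : Fin (m + 1) → Fin (m + 1) → ℝ | ∀ i, y i ⬝ᵥ y i < 1} 1
        (fun i => (Fin.cons (x i) (z i) : Fin (m + 1) → ℝ)) = F x z := by
    simp [F, Set.indicator, cons_dotProduct_self, add_comm]
  simp_rw [h2]
  rw [lintegral_hyperplane hF]
  have hmeas1 : Measurable fun h : ℝ => Set.indicator (Set.Ioo (-1 : ℝ) 1)
      (fun h => ENNReal.ofReal (√(1 - h ^ 2) ^ (m * (m + 2)))) h :=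
    Measurable.indicator (by fun_prop) measurableSet_Ioo
  have hmeas2 : Measurable fun c : Fin m → ℝ =>
      ENNReal.ofReal ((√(1 + c ⬝ᵥ c))⁻¹ ^ (m + 1)) := by
    have : Continuous fun c : Fin m → ℝ => c ⬝ᵥ c := by fun_prop
    have := this.measurable
    fun_prop
  rw [mul_assoc, ← lintegral_mul_const _ hmeas2, ← lintegral_const_mul _ (hmeas2.mul_const _)]
  refine lintegral_congr fun c => ?_
  have hq := sqrt_one_add_dotProduct_pos c
  have hpow : √(1 + c ⬝ᵥ c) * (√(1 + c ⬝ᵥ c))⁻¹ ^ (m + 2) = (√(1 + c ⬝ᵥ c))⁻¹ ^ (m + 1) := by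
    rw [pow_succ' _ (m + 1), mul_inv_cancel_left₀ hq.ne']
  have h3 (h : ℝ) : ∫⁻ z : Fin (m + 1) → Fin m → ℝ, ENNReal.ofReal |(homMatrix z).det| *
        F (fun i => √(1 + c ⬝ᵥ c) * h + z i ⬝ᵥ c) z =
      Set.indicator (Set.Ioo (-1 : ℝ) 1) (fun h => ENNReal.ofReal (√(1 - h ^ 2) ^ (m * (m + 2)))) h *
        (ENNReal.ofReal ((√(1 + c ⬝ᵥ c))⁻¹ ^ (m + 2)) * simplexIntegral m) := by
    rw [← mul_assoc, ← lintegral_ellipsoid]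
    refine lintegral_congr fun z => ?_
    simp [F, Set.indicator]
  rw [lintegral_real_scale _ hq]
  simp_rw [h3]
  rw [lintegral_mul_const _ hmeas1, lintegral_indicator measurableSet_Ioo, mul_left_comm,
    ← mul_assoc (ENNReal.ofReal _), ← ENNReal.ofReal_mul hq.le, hpow]

theorem mem_convexHull_range_iff {ι E : Type*} [Fintype ι] [AddCommGroup E] [Module ℝ E]
    (z : ι → E) (x : E) :
    x ∈ convexHull ℝ (Set.range z) ↔
      ∃ t : ι → ℝ, (∀ i, 0 ≤ t i) ∧ ∑ i, t i = 1 ∧ ∑ i, t i • z i = x := by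
  classical
  constructor
  · intro hx
    have h : Set.range z = Fintype.linearCombination ℝ z ''
        Set.range (fun i : ι => (Pi.single i 1 : ι → ℝ)) := by
      rw [← Set.range_comp]
      congr 1
      ext i
      simp
    rw [h, ← LinearMap.image_convexHull, convexHull_rangle_single_eq_stdSimplex] at hx
    obtain ⟨t, ht, rfl⟩ := hx
    exact ⟨t, ht.1, ht.2, by simp [Fintype.linearCombination_apply]⟩
  · rintro ⟨t, h0, h1, h2⟩
    exact mem_convexHull_of_exists_fintype t z h0 h1 (fun i => Set.mem_range_self i) h2

theorem lintegral_pow_mul_exp_neg (m : ℕ) :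
    ∫⁻ x in Set.Ioi (0 : ℝ), ENNReal.ofReal (x ^ m * exp (-x)) = m.factorial := by
  have hs : (0 : ℝ) < (m : ℝ) + 1 := by positivity
  have hG := Gamma_eq_integral hs
  have hI := GammaIntegral_convergent hs
  have he : ∀ x ∈ Set.Ioi (0 : ℝ), exp (-x) * x ^ ((m : ℝ) + 1 - 1) = x ^ m * exp (-x) := by
    intro x _
    rw [add_sub_cancel_right, rpow_natCast, mul_comm]
  rw [setIntegral_congr_fun measurableSet_Ioi he, Gamma_nat_eq_factorial] at hG
  rw [integrableOn_congr_fun he measurableSet_Ioi] at hI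
  rw [← ofReal_integral_eq_lintegral_ofReal hI, ← hG, ENNReal.ofReal_natCast]
  filter_upwards [ae_restrict_mem measurableSet_Ioi] with x hx
  have : 0 < x := hx
  positivity

theorem lintegral_orthant_exp_neg_sum (k : ℕ) :
    ∫⁻ t : Fin k → ℝ, Set.indicator {t | ∀ i, 0 ≤ t i}
      (fun t => ENNReal.ofReal (exp (-∑ i, t i))) t = 1 := by
  induction k with
  | zero => simp [volume_pi]
  | succ k ih =>
    have hm (k : ℕ) : Measurable fun t : Fin k → ℝ => Set.indicator {t : Fin k → ℝ | ∀ i, 0 ≤ t i}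
        (fun t => ENNReal.ofReal (exp (-∑ i, t i))) t := by
      refine Measurable.indicator (by fun_prop) ?_
      rw [Set.ofPred_forall]
      exact MeasurableSet.iInter fun i =>
        measurableSet_le measurable_const (measurable_pi_apply i)
    rw [lintegral_real_cons (hm (k + 1))]
    have h (x : ℝ) (z : Fin k → ℝ) : Set.indicator {t : Fin (k + 1) → ℝ | ∀ i, 0 ≤ t i}
        (fun t => ENNReal.ofReal (exp (-∑ i, t i))) (Fin.cons x z : Fin (k + 1) → ℝ) =
        Set.indicator (Set.Ici (0 : ℝ)) (fun x => ENNReal.ofReal (exp (-x))) x *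
          Set.indicator {t : Fin k → ℝ | ∀ i, 0 ≤ t i}
            (fun t => ENNReal.ofReal (exp (-∑ i, t i))) z := by
      by_cases h1 : 0 ≤ x <;> by_cases h2 : ∀ i, 0 ≤ z i <;>
        simp [Set.indicator, Fin.forall_fin_succ, Fin.sum_univ_succ, h1, h2, Real.exp_add,
          ENNReal.ofReal_mul (exp_pos _).le, mul_comm]
    simp_rw [h]
    have h0 := lintegral_pow_mul_exp_neg 0
    simp only [pow_zero, one_mul, Nat.factorial_zero, Nat.cast_one] at h0
    simp_rw [lintegral_const_mul _ (hm k), ih, mul_one]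
    rw [lintegral_indicator measurableSet_Ici, Measure.restrict_congr_set Ioi_ae_eq_Ici.symm, h0]

/-- The volume of a simplex in terms of the determinant of its homogeneous coordinates. -/
theorem factorial_mul_volume_convexHull {m : ℕ} (z : Fin (m + 1) → Fin m → ℝ)
    (hz : (homMatrix z).det ≠ 0) :
    m.factorial * volume (convexHull ℝ (Set.range z)) = ENNReal.ofReal |(homMatrix z).det| := by
  have hu : IsUnit (homMatrix z).det := hz.isUnit
  let F : (Fin (m + 1) → ℝ) → ℝ≥0∞ :=
    Set.indicator {y | ∀ i, 0 ≤ (y ᵥ* (homMatrix z)⁻¹) i} fun y => ENNReal.ofReal (exp (-y 0))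
  have hc : Continuous fun y : Fin (m + 1) → ℝ => y ᵥ* (homMatrix z)⁻¹ := by fun_prop
  have hset : MeasurableSet {y : Fin (m + 1) → ℝ | ∀ i, 0 ≤ (y ᵥ* (homMatrix z)⁻¹) i} := by
    rw [Set.ofPred_forall]
    exact MeasurableSet.iInter fun i =>
      measurableSet_le measurable_const ((measurable_pi_apply i).comp hc.measurable)
  have hF : Measurable F := Measurable.indicator (by fun_prop) hset
  have hconv (x : Fin m → ℝ) : (∀ i, 0 ≤ ((Fin.cons 1 x : Fin (m + 1) → ℝ) ᵥ*
      (homMatrix z)⁻¹) i) ↔ x ∈ convexHull ℝ (Set.range z) := by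
    rw [mem_convexHull_range_iff]
    constructor
    · intro h
      have h2 := homMatrix_vecMul z ((Fin.cons 1 x : Fin (m + 1) → ℝ) ᵥ* (homMatrix z)⁻¹)
      rw [Matrix.vecMul_vecMul, Matrix.nonsing_inv_mul _ hu, Matrix.vecMul_one] at h2
      exact ⟨_, h, (Fin.cons_inj.1 h2).1.symm, (Fin.cons_inj.1 h2).2.symm⟩
    · rintro ⟨t, h0, h1, rfl⟩
      rwa [← h1, ← homMatrix_vecMul, Matrix.vecMul_vecMul, Matrix.mul_nonsing_inv _ hu,
        Matrix.vecMul_one]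
  have hmeas : MeasurableSet (convexHull ℝ (Set.range z)) := by
    have : convexHull ℝ (Set.range z) = (fun x : Fin m → ℝ => (Fin.cons 1 x : Fin (m + 1) → ℝ)) ⁻¹'
        {y : Fin (m + 1) → ℝ | ∀ i, 0 ≤ (y ᵥ* (homMatrix z)⁻¹) i} :=
      Set.ext fun x => (hconv x).symm
    rw [this]
    exact hset.preimage (measurable_const.finCons measurable_id)
  have h1 : ∫⁻ y, F y = ENNReal.ofReal |(homMatrix z).det| := by
    rw [lintegral_comp_linearMap_add volume (Matrix.toLin' (homMatrix z)ᵀ) (by simpa using hz) 0]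
    rw [← mul_one (ENNReal.ofReal |(homMatrix z).det|), ← lintegral_orthant_exp_neg_sum (m + 1)]
    congr 1
    · simp
    · refine lintegral_congr fun t => ?_
      have h : Matrix.toLin' (homMatrix z)ᵀ t + 0 = t ᵥ* homMatrix z := by
        simp [Matrix.mulVec_transpose]
      have h' : t ᵥ* homMatrix z ᵥ* (homMatrix z)⁻¹ = t := by
        rw [Matrix.vecMul_vecMul, Matrix.mul_nonsing_inv _ hu, Matrix.vecMul_one]
      have h0 : (t ᵥ* homMatrix z) 0 = ∑ i, t i := by simp [homMatrix_vecMul]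
      simp only [F, Set.indicator, Set.mem_ofPred_eq, h, h', h0]
  have hslice (r : ℝ) (hr : 0 < r) : ∫⁻ x : Fin m → ℝ, F (Fin.cons r x : Fin (m + 1) → ℝ) =
      ENNReal.ofReal (r ^ m * exp (-r)) * volume (convexHull ℝ (Set.range z)) := by
    rw [lintegral_pi_smul _ hr.ne', abs_of_pos hr]
    have h (x : Fin m → ℝ) : F (Fin.cons r (r • x) : Fin (m + 1) → ℝ) =
        ENNReal.ofReal (exp (-r)) * Set.indicator (convexHull ℝ (Set.range z)) 1 x := by
      have hcons : (Fin.cons r (r • x) : Fin (m + 1) → ℝ) = r • Fin.cons 1 x := by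
        ext j
        refine Fin.cases ?_ (fun j => ?_) j <;> simp
      have : (∀ i, 0 ≤ ((Fin.cons r (r • x) : Fin (m + 1) → ℝ) ᵥ* (homMatrix z)⁻¹) i) ↔
          x ∈ convexHull ℝ (Set.range z) := by
        rw [← hconv, hcons, Matrix.smul_vecMul]
        simp [hr]
      by_cases hx : x ∈ convexHull ℝ (Set.range z) <;>
        simp only [F, Set.indicator, Set.mem_ofPred_eq, this, hx] <;> simp
    simp_rw [h]
    rw [lintegral_const_mul' _ _ ENNReal.ofReal_ne_top, lintegral_indicator_one hmeas,
      ENNReal.ofReal_mul (by positivity), mul_assoc]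
  have hneg (r : ℝ) (hr : r < 0) (x : Fin m → ℝ) : F (Fin.cons r x : Fin (m + 1) → ℝ) = 0 := by
    refine Set.indicator_of_notMem (fun h => ?_) _
    have h2 := homMatrix_vecMul z ((Fin.cons r x : Fin (m + 1) → ℝ) ᵥ* (homMatrix z)⁻¹)
    rw [Matrix.vecMul_vecMul, Matrix.nonsing_inv_mul _ hu, Matrix.vecMul_one] at h2
    have h3 := (Fin.cons_inj.1 h2).1
    have h4 := Finset.sum_nonneg fun i (_ : i ∈ Finset.univ) => h i
    linarith
  rw [← h1, lintegral_real_cons hF, ← lintegral_pow_mul_exp_neg m, ← lintegral_mul_const _ (by fun_prop),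
    ← lintegral_indicator measurableSet_Ioi]
  refine lintegral_congr_ae ?_
  filter_upwards [(measure_eq_zero_iff_ae_notMem.1 (volume_singleton (a := (0 : ℝ))))] with r hr
  rcases lt_or_gt_of_ne hr with h | h
  · simp [hneg r h, h.le]
  · simp [hslice r h, h]

theorem measurableSet_mem_convexHull_range {E : Type*} [NormedAddCommGroup E] [NormedSpace ℝ E]
    [FiniteDimensional ℝ E] [MeasurableSpace E] [BorelSpace E] (k : ℕ) :
    MeasurableSet {p : E × (Fin k → E) | p.1 ∈ convexHull ℝ (Set.range p.2)} := by
  have hC : IsClosed {q : (E × (Fin k → E)) × (Fin k → ℝ) | (∀ i, 0 ≤ q.2 i) ∧ ∑ i, q.2 i = 1 ∧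
      ∑ i, q.2 i • q.1.2 i = q.1.1} := by
    refine IsClosed.inter ?_ ((isClosed_eq (by fun_prop) (by fun_prop)).inter
      (isClosed_eq (by fun_prop) (by fun_prop)))
    exact (isClosed_le continuous_const continuous_id).preimage continuous_snd
  convert hC.measurableSet_image_of_continuous continuous_fst using 1
  ext p
  simp [mem_convexHull_range_iff]

theorem pi_smul_restrict {k : ℕ} {α : Type*} [MeasurableSpace α] (μ : Measure α) [SigmaFinite μ]
    (c : ℝ≥0∞) (hc : c ≠ ∞) (B : Set α) :
    Measure.pi (fun _ : Fin k => c • μ.restrict B) =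
      c ^ k • (Measure.pi fun _ => μ).restrict {z | ∀ i, z i ∈ B} := by
  lift c to NNReal using hc
  have hB : {z : Fin k → α | ∀ i, z i ∈ B} = Set.univ.pi fun _ => B := by ext; simp
  rw [hB, Measure.restrict_pi_pi]
  have : SigmaFinite ((c : ℝ≥0∞) • μ.restrict B) := by
    change SigmaFinite (c • μ.restrict B)
    infer_instance
  refine Measure.pi_eq fun s hs => ?_
  simp [Finset.prod_mul_distrib]

/-- The uniform distribution on the unit ball. -/
def ballUnif (m : ℕ) : Measure (Fin m → ℝ) :=
  (ballVol m)⁻¹ • volume.restrict {z | z ⬝ᵥ z < 1}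

instance (m : ℕ) : IsProbabilityMeasure (ballUnif m) :=
  ⟨by
    rw [ballUnif, Measure.smul_apply, Measure.restrict_apply_univ, smul_eq_mul]
    exact ENNReal.inv_mul_cancel (ballVol_ne_zero m) (ballVol_ne_top m)⟩

theorem convex_dotProduct_lt_one (m : ℕ) : Convex ℝ {z : Fin m → ℝ | z ⬝ᵥ z < 1} := by
  have h : {z : Fin m → ℝ | z ⬝ᵥ z < 1} =
      (EuclideanSpace.equiv (Fin m) ℝ).symm ⁻¹' Metric.ball 0 1 := by
    ext z
    rw [Set.mem_ofPred_eq, Set.mem_preimage, mem_ball_zero_iff, ← norm_toLp_sq,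
      sq_lt_one_iff₀ (norm_nonneg _)]
    rfl
  rw [h]
  exact (convex_ball _ _).linear_preimage
    (EuclideanSpace.equiv (Fin m) ℝ).symm.toLinearMap

theorem pi_ballUnif_head_mem_convexHull (m : ℕ) :
    Measure.pi (fun _ : Fin (m + 2) => ballUnif m)
      {y | y 0 ∈ convexHull ℝ (Set.range fun i : Fin (m + 1) => y i.succ)} =
        (ballVol m)⁻¹ ^ (m + 2) * (simplexIntegral m / m.factorial) := by
  have hS := measurableSet_mem_convexHull_range (E := Fin m → ℝ) (m + 1)
  have hS' : MeasurableSet {y : Fin (m + 2) → Fin m → ℝ |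
      y 0 ∈ convexHull ℝ (Set.range fun i : Fin (m + 1) => y i.succ)} :=
    hS.preimage (f := fun y : Fin (m + 2) → Fin m → ℝ => (y 0, fun i : Fin (m + 1) => y i.succ))
      (by fun_prop)
  have hfact : (m.factorial : ℝ≥0∞) ≠ 0 := by exact_mod_cast m.factorial_ne_zero
  have hc : (ballVol m)⁻¹ ≠ ∞ := ENNReal.inv_ne_top.2 (ballVol_ne_zero m)
  rw [← lintegral_indicator_one hS', lintegral_pi_cons _ (measurable_one.indicator hS')]
  have h1 (x : Fin m → ℝ) (z : Fin (m + 1) → Fin m → ℝ) :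
      Set.indicator {y : Fin (m + 2) → Fin m → ℝ |
        y 0 ∈ convexHull ℝ (Set.range fun i : Fin (m + 1) => y i.succ)}
        (1 : (Fin (m + 2) → Fin m → ℝ) → ℝ≥0∞) (Fin.cons x z : Fin (m + 2) → Fin m → ℝ) =
      Set.indicator {p : (Fin m → ℝ) × (Fin (m + 1) → Fin m → ℝ) |
        p.1 ∈ convexHull ℝ (Set.range p.2)} 1 (x, z) := rfl
  simp_rw [h1]
  rw [lintegral_lintegral_swap (f := fun x z => Set.indicator
    {p : (Fin m → ℝ) × (Fin (m + 1) → Fin m → ℝ) | p.1 ∈ convexHull ℝ (Set.range p.2)} 1 (x, z))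
    (measurable_one.indicator hS).aemeasurable]
  have h2 (z : Fin (m + 1) → Fin m → ℝ) : ∫⁻ x, Set.indicator
      {p : (Fin m → ℝ) × (Fin (m + 1) → Fin m → ℝ) | p.1 ∈ convexHull ℝ (Set.range p.2)} 1 (x, z)
      ∂(ballUnif m) = ballUnif m (convexHull ℝ (Set.range z)) := by
    have : MeasurableSet (convexHull ℝ (Set.range z)) :=
      hS.preimage (f := fun x : Fin m → ℝ => (x, z)) (by fun_prop)
    rw [← lintegral_indicator_one this]
    rfl
  simp_rw [h2]
  have hBm : MeasurableSet {z : Fin (m + 1) → Fin m → ℝ | ∀ i, z i ∈ {z : Fin m → ℝ | z ⬝ᵥ z < 1}} := by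
    rw [Set.ofPred_forall]
    exact MeasurableSet.iInter fun i =>
      (measurableSet_dotProduct_lt m 1).preimage (measurable_pi_apply i)
  have hpi : Measure.pi (fun _ : Fin (m + 1) => ballUnif m) = (ballVol m)⁻¹ ^ (m + 1) •
      (volume : Measure (Fin (m + 1) → Fin m → ℝ)).restrict
        {z | ∀ i, z i ∈ {z : Fin m → ℝ | z ⬝ᵥ z < 1}} :=
    pi_smul_restrict _ _ hc _
  rw [hpi, lintegral_smul_measure, smul_eq_mul, pow_succ _ (m + 1), mul_assoc]
  congr 1
  rw [simplexIntegral, div_eq_mul_inv, mul_comm (lintegral _ _),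
    ← lintegral_const_mul' _ _ (ENNReal.inv_ne_top.2 hfact), ← lintegral_const_mul' _ _ hc,
    ← lintegral_indicator hBm]
  refine lintegral_congr_ae ?_
  filter_upwards [ae_det_homMatrix_ne_zero m] with z hz
  by_cases hzB : ∀ i, z i ⬝ᵥ z i < 1
  · have hsub : convexHull ℝ (Set.range z) ⊆ {z : Fin m → ℝ | z ⬝ᵥ z < 1} :=
      convexHull_min (by rintro _ ⟨i, rfl⟩; exact hzB i) (convex_dotProduct_lt_one m)
    have : MeasurableSet (convexHull ℝ (Set.range z)) :=
      hS.preimage (f := fun x : Fin m → ℝ => (x, z)) (by fun_prop)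
    simp only [Set.indicator, Set.mem_ofPred_eq, hzB, implies_true, if_true]
    rw [← factorial_mul_volume_convexHull z hz, ← mul_assoc (m.factorial : ℝ≥0∞)⁻¹,
      ENNReal.inv_mul_cancel hfact (ENNReal.natCast_ne_top _), one_mul, ballUnif,
      Measure.smul_apply, Measure.restrict_apply this, Set.inter_eq_left.2 hsub, smul_eq_mul]
  · simp [Set.indicator, hzB]

theorem lintegral_arcsine_density :
    ∫⁻ x in Set.Ioo (-1 : ℝ) 1, ENNReal.ofReal ((1 - x ^ 2) ^ (-(1 / 2) : ℝ)) = ENNReal.ofReal π := by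
  have himg : sin '' Set.Ioo (-(π / 2)) (π / 2) = Set.Ioo (-1) 1 := by
    ext y
    constructor
    · rintro ⟨x, hx, rfl⟩
      have h1 := strictMonoOn_sin (Set.left_mem_Icc.2 (by linarith [pi_pos]))
        (Set.Ioo_subset_Icc_self hx) hx.1
      have h2 := strictMonoOn_sin (Set.Ioo_subset_Icc_self hx)
        (Set.right_mem_Icc.2 (by linarith [pi_pos])) hx.2
      rw [sin_neg, sin_pi_div_two] at h1
      rw [sin_pi_div_two] at h2
      exact ⟨h1, h2⟩
    · intro hy
      exact ⟨arcsin y, ⟨neg_pi_div_two_lt_arcsin.2 hy.1, arcsin_lt_pi_div_two.2 hy.2⟩,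
        sin_arcsin hy.1.le hy.2.le⟩
  rw [← himg, lintegral_image_eq_lintegral_abs_deriv_mul measurableSet_Ioo
    (fun x _ => (hasDerivAt_sin x).hasDerivWithinAt)
    (injOn_sin.mono Set.Ioo_subset_Icc_self)]
  have h : ∀ x ∈ Set.Ioo (-(π / 2)) (π / 2), ENNReal.ofReal |cos x| *
      ENNReal.ofReal ((1 - sin x ^ 2) ^ (-(1 / 2) : ℝ)) = 1 := by
    intro x hx
    have hcos := cos_pos_of_mem_Ioo hx
    rw [← cos_sq', ← ENNReal.ofReal_mul (abs_nonneg _), rpow_neg (by positivity), ← sqrt_eq_rpow,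
      sqrt_sq_eq_abs, mul_inv_cancel₀ (by positivity), ENNReal.ofReal_one]
  rw [setLIntegral_congr_fun measurableSet_Ioo h]
  simp

theorem lintegral_arcsine_density_scaled {r : ℝ} (hr : 0 < r) :
    ∫⁻ x : ℝ, ENNReal.ofReal (if x ^ 2 < r then (r - x ^ 2) ^ (-(1 / 2) : ℝ) else 0) =
      ENNReal.ofReal π := by
  have hq : 0 < √r := sqrt_pos.2 hr
  rw [lintegral_real_scale _ hq, ← lintegral_const_mul' _ _ ENNReal.ofReal_ne_top,
    ← lintegral_arcsine_density, ← lintegral_indicator measurableSet_Ioo]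
  refine lintegral_congr fun x => ?_
  have h1 : x ∈ Set.Ioo (-1 : ℝ) 1 ↔ x ^ 2 < 1 := by
    rw [sq_lt_one_iff_abs_lt_one, abs_lt, Set.mem_Ioo]
  rw [mul_pow, sq_sqrt hr.le]
  by_cases hx : x ^ 2 < 1
  · rw [if_pos (by nlinarith), Set.indicator_of_mem (h1.2 hx), ← ENNReal.ofReal_mul hq.le]
    congr 1
    rw [show r - r * x ^ 2 = r * (1 - x ^ 2) by ring, mul_rpow hr.le (by linarith),
      rpow_neg hr.le, ← sqrt_eq_rpow, mul_inv_cancel_left₀ hq.ne']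
  · rw [if_neg (by nlinarith), Set.indicator_of_notMem (h1.not.2 hx)]
    simp

/-- The map forgetting the coordinate with index `0`. -/
def tailMap (m : ℕ) : EuclideanSpace ℝ (Fin (m + 1)) →ₗ[ℝ] (Fin m → ℝ) where
  toFun x i := x i.succ
  map_add' _ _ := rfl
  map_smul' _ _ := rfl

theorem tailMap_apply {m : ℕ} (x : EuclideanSpace ℝ (Fin (m + 1))) (i : Fin m) :
    tailMap m x i = x i.succ :=
  rfl

theorem measurable_betaDensity (d : ℕ) (β : ℝ) : Measurable (betaDensity d β) :=
  Measurable.const_mul (Measurable.ite (measurableSet_lt measurable_norm measurable_const)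
    (by fun_prop) measurable_const) _

theorem betaMeasure_neg_one_half (d : ℕ) : betaMeasure d (-(1 / 2)) =
    volume.withDensity fun x => ENNReal.ofReal (betaDensity d (-(1 / 2)) x) :=
  if_neg (by norm_num)

theorem ofReal_beta_constant_mul_pi (m : ℕ) :
    ENNReal.ofReal (Gamma (((m + 1 : ℕ) : ℝ) / 2 + -(1 / 2) + 1) /
      (π ^ (((m + 1 : ℕ) : ℝ) / 2) * Gamma (-(1 / 2) + 1))) * ENNReal.ofReal π = (ballVol m)⁻¹ := by
  have hG : 0 < Gamma ((m : ℝ) / 2 + 1) := Gamma_pos_of_pos (by positivity)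
  rw [ballVol_eq, ← ENNReal.ofReal_inv_of_pos (by positivity), ← ENNReal.ofReal_mul' pi_pos.le,
    show ((m + 1 : ℕ) : ℝ) / 2 + -(1 / 2) + 1 = (m : ℝ) / 2 + 1 by push_cast; ring,
    show (-(1 / 2) + 1 : ℝ) = 1 / 2 by norm_num, Gamma_one_half_eq,
    rpow_div_two_eq_sqrt _ pi_pos.le, rpow_natCast]
  congr 1
  have : √π * √π = π := mul_self_sqrt pi_pos.le
  have h0 : √π ≠ 0 := by positivity
  field_simp
  rw [pow_succ, mul_assoc, this, mul_comm]

theorem map_tailMap_betaMeasure (m : ℕ) :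
    (betaMeasure (m + 1) (-(1 / 2))).map (tailMap m) = ballUnif m := by
  have ht : Measurable (tailMap m) := (tailMap m).continuous_of_finiteDimensional.measurable
  have hd : Measurable fun x => ENNReal.ofReal (betaDensity (m + 1) (-(1 / 2)) x) :=
    (measurable_betaDensity _ _).ennreal_ofReal
  refine Measure.ext fun s hs => ?_
  have hball := measurableSet_dotProduct_lt m 1
  have hcomp : Measurable fun y : Fin (m + 1) → ℝ => (tailMap m ⁻¹' s).indicator
      (fun x => ENNReal.ofReal (betaDensity (m + 1) (-(1 / 2)) x)) (WithLp.toLp 2 y) :=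
    (hd.indicator (ht hs)).comp (PiLp.volume_preserving_toLp (Fin (m + 1))).measurable
  rw [Measure.map_apply ht hs, betaMeasure_neg_one_half, withDensity_apply _ (ht hs),
    ← lintegral_indicator (ht hs),
    ← (PiLp.volume_preserving_toLp (Fin (m + 1))).lintegral_comp (hd.indicator (ht hs)),
    lintegral_real_cons hcomp,
    lintegral_lintegral_swap, ballUnif, Measure.smul_apply, Measure.restrict_apply hs, smul_eq_mul,
    ← lintegral_indicator_one (hs.inter hball), ← lintegral_const_mul' _ _
      (ENNReal.inv_ne_top.2 (ballVol_ne_zero m))]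
  · refine lintegral_congr fun z => ?_
    have hnorm (x : ℝ) : ‖(WithLp.toLp 2 (Fin.cons x z : Fin (m + 1) → ℝ) :
        EuclideanSpace ℝ (Fin (m + 1)))‖ ^ 2 = x ^ 2 + z ⬝ᵥ z := by
      rw [norm_toLp_sq, cons_dotProduct_self]
    have hmem (x : ℝ) : WithLp.toLp 2 (Fin.cons x z : Fin (m + 1) → ℝ) ∈ tailMap m ⁻¹' s ↔ z ∈ s :=
      Iff.rfl
    have hdens (x : ℝ) : betaDensity (m + 1) (-(1 / 2))
        (WithLp.toLp 2 (Fin.cons x z : Fin (m + 1) → ℝ)) =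
        (Gamma (((m + 1 : ℕ) : ℝ) / 2 + -(1 / 2) + 1) /
          (π ^ (((m + 1 : ℕ) : ℝ) / 2) * Gamma (-(1 / 2) + 1))) *
        (if x ^ 2 < 1 - z ⬝ᵥ z then (1 - z ⬝ᵥ z - x ^ 2) ^ (-(1 / 2) : ℝ) else 0) := by
      simp only [betaDensity, ← sq_lt_one_iff₀ (norm_nonneg _), hnorm, sub_add_eq_sub_sub_swap,
        lt_sub_iff_add_lt]
    have hcpos : 0 ≤ Gamma (((m + 1 : ℕ) : ℝ) / 2 + -(1 / 2) + 1) /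
          (π ^ (((m + 1 : ℕ) : ℝ) / 2) * Gamma (-(1 / 2) + 1)) := by
      refine div_nonneg (Gamma_nonneg_of_nonneg ?_) (mul_nonneg (by positivity)
        (Gamma_nonneg_of_nonneg (by norm_num)))
      push_cast
      linarith [(Nat.cast_nonneg m : (0 : ℝ) ≤ m)]
    by_cases hzs : z ∈ s
    · simp only [Set.indicator, hmem, hzs, if_true, hdens, ENNReal.ofReal_mul hcpos, Set.mem_inter_iff,
        true_and, Set.mem_ofPred_eq]
      rw [lintegral_const_mul' _ _ ENNReal.ofReal_ne_top]
      by_cases hz : z ⬝ᵥ z < 1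
      · rw [lintegral_arcsine_density_scaled (by linarith), ofReal_beta_constant_mul_pi]
        simp [hz]
      · have (x : ℝ) : ¬ x ^ 2 < 1 - z ⬝ᵥ z := by nlinarith [sq_nonneg x]
        simp [hz, this]
    · simp [Set.indicator, hmem, hzs]
  · exact (hcomp.comp measurable_finCons).aemeasurable

instance (m : ℕ) : IsProbabilityMeasure (betaMeasure (m + 1) (-(1 / 2))) := by
  have ht : Measurable (tailMap m) := (tailMap m).continuous_of_finiteDimensional.measurable
  have : IsProbabilityMeasure ((betaMeasure (m + 1) (-(1 / 2))).map (tailMap m)) := by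
    rw [map_tailMap_betaMeasure]
    infer_instance
  exact Measure.isProbabilityMeasure_of_map (tailMap m)

theorem betaMeasure_absolutelyContinuous (d : ℕ) : betaMeasure d (-(1 / 2)) ≪ volume := by
  rw [betaMeasure_neg_one_half]
  exact withDensity_absolutelyContinuous _ _

theorem measurePreserving_betaMeasure (d : ℕ)
    (L : EuclideanSpace ℝ (Fin d) ≃ₗᵢ[ℝ] EuclideanSpace ℝ (Fin d)) :
    MeasurePreserving L (betaMeasure d (-(1 / 2))) (betaMeasure d (-(1 / 2))) := by
  refine ⟨L.continuous.measurable, Measure.ext fun s hs => ?_⟩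
  have hd : Measurable fun x => ENNReal.ofReal (betaDensity d (-(1 / 2)) x) :=
    (measurable_betaDensity _ _).ennreal_ofReal
  rw [Measure.map_apply L.continuous.measurable hs, betaMeasure_neg_one_half,
    withDensity_apply _ hs, withDensity_apply _ (L.continuous.measurable hs),
    ← L.measurePreserving.setLIntegral_comp_preimage hs hd]
  simp [betaDensity]

section Directions

variable {E F : Type*} [AddCommGroup E] [Module ℝ E] [AddCommGroup F] [Module ℝ F]

theorem exists_segment_of_mem_convexHull_range {k : ℕ} [NeZero k] {X : Fin (k + 1) → E} {p : E}
    (hp : p ∈ convexHull ℝ (Set.range X)) (hpX : p ≠ X 0) :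
    ∃ a : ℝ, 0 < a ∧ ∃ q ∈ convexHull ℝ (Set.range fun i : Fin k => X i.succ),
      p - X 0 = a • (q - X 0) := by
  have hr : Set.range X = insert (X 0) (Set.range fun i : Fin k => X i.succ) := by
    ext x
    simp [Fin.exists_fin_succ, eq_comm]
  rw [hr, convexHull_insert (Set.range_nonempty _), mem_convexJoin] at hp
  obtain ⟨x, rfl, q, hq, hpq⟩ := hp
  rw [segment_eq_image'] at hpq
  obtain ⟨a, ha, rfl⟩ := hpq
  refine ⟨a, lt_of_le_of_ne ha.1 ?_, q, hq, by simp⟩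
  rintro rfl
  simp at hpX

/-- The directions `e` and `-e` seen from the vertex `X 0` of a simplex: one of them points into
the simplex iff the projection of `X 0` along `e` lies in the projection of the opposite face. -/
theorem exists_add_smul_mem_convexHull_or_iff {k : ℕ} [NeZero k] {X : Fin (k + 1) → E} {e : E}
    (f : E →ₗ[ℝ] F) (he : e ≠ 0) (hfe : f e = 0) (hker : ∀ x, f x = 0 → ∃ c : ℝ, x = c • e)
    (hX : X 0 ∉ convexHull ℝ (Set.range fun i : Fin k => X i.succ)) :
    ((∃ ε : ℝ, 0 < ε ∧ X 0 + ε • e ∈ convexHull ℝ (Set.range X)) ∨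
      ∃ ε : ℝ, 0 < ε ∧ X 0 + ε • -e ∈ convexHull ℝ (Set.range X)) ↔
    f (X 0) ∈ convexHull ℝ (Set.range fun i : Fin k => f (X i.succ)) := by
  have hr : (Set.range fun i : Fin k => f (X i.succ)) = f '' Set.range fun i : Fin k => X i.succ := by
    rw [← Set.range_comp]
    rfl
  rw [hr, ← LinearMap.image_convexHull]
  have key : ∀ e' : E, e' ≠ 0 → f e' = 0 →
      (∃ ε : ℝ, 0 < ε ∧ X 0 + ε • e' ∈ convexHull ℝ (Set.range X)) →
      f (X 0) ∈ f '' convexHull ℝ (Set.range fun i : Fin k => X i.succ) := by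
    rintro e' he' hfe' ⟨ε, hε, h⟩
    obtain ⟨a, ha, q, hq, h2⟩ := exists_segment_of_mem_convexHull_range h
      (by simpa [hε.ne'] using he')
    refine ⟨q, hq, ?_⟩
    have h3 := congrArg f h2
    simp only [add_sub_cancel_left, map_smul, hfe', smul_zero, map_sub] at h3
    exact sub_eq_zero.1 ((smul_eq_zero.1 h3.symm).resolve_left ha.ne')
  constructor
  · rintro (h | h)
    · exact key e he hfe h
    · exact key (-e) (neg_ne_zero.2 he) (by simp [hfe]) h
  · rintro ⟨q, hq, hfq⟩
    obtain ⟨c, hc⟩ := hker (q - X 0) (by simp [hfq])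
    have hqX : q ∈ convexHull ℝ (Set.range X) := by
      refine convexHull_mono ?_ hq
      rintro _ ⟨i, rfl⟩
      exact Set.mem_range_self _
    rcases lt_trichotomy c 0 with h | rfl | h
    · exact Or.inr ⟨-c, by linarith, by rwa [neg_smul_neg, ← hc, add_sub_cancel]⟩
    · rw [zero_smul, sub_eq_zero] at hc
      exact absurd (hc ▸ hq) hX
    · exact Or.inl ⟨c, h, by rwa [← hc, add_sub_cancel]⟩

theorem not_exists_add_smul_mem_convexHull_and {k : ℕ} [NeZero k] {X : Fin (k + 1) → E} {e : E}
    (he : e ≠ 0) (hX : X 0 ∉ convexHull ℝ (Set.range fun i : Fin k => X i.succ)) :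
    ¬((∃ ε : ℝ, 0 < ε ∧ X 0 + ε • e ∈ convexHull ℝ (Set.range X)) ∧
      ∃ ε : ℝ, 0 < ε ∧ X 0 + ε • -e ∈ convexHull ℝ (Set.range X)) := by
  rintro ⟨⟨ε, hε, h⟩, δ, hδ, h'⟩
  obtain ⟨a, ha, q, hq, h2⟩ := exists_segment_of_mem_convexHull_range h (by simpa [hε.ne'] using he)
  obtain ⟨b, hb, q', hq', h2'⟩ := exists_segment_of_mem_convexHull_range h'
    (by simpa [hδ.ne'] using he)
  rw [add_sub_cancel_left] at h2 h2'
  refine hX ?_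
  have hs : 0 < δ * a + ε * b := by positivity
  have h3 : X 0 = (δ * a / (δ * a + ε * b)) • q + (ε * b / (δ * a + ε * b)) • q' := by
    have h4 : (δ * a) • (q - X 0) + (ε * b) • (q' - X 0) = 0 := by
      rw [mul_smul, mul_smul, ← h2, ← h2', smul_smul, smul_smul, smul_neg, mul_comm, add_neg_cancel]
    have h5 : (δ * a + ε * b) • X 0 = (δ * a) • q + (ε * b) • q' := by
      rw [smul_sub, smul_sub] at h4
      rw [add_smul, ← sub_eq_zero, ← neg_eq_zero, ← h4]
      abel
    rw [div_eq_inv_mul, div_eq_inv_mul, mul_smul _ (δ * a), mul_smul _ (ε * b), ← smul_add, ← h5, smul_smul,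
      inv_mul_cancel₀ hs.ne', one_smul]
  rw [h3]
  exact convex_convexHull ℝ _ hq hq' (by positivity) (by positivity) (by field_simp)

end Directions

instance isProbabilityMeasure_sphereUnif (m : ℕ) : IsProbabilityMeasure (sphereUnif (m + 1)) :=
  ⟨by
    rw [sphereUnif, Measure.smul_apply, smul_eq_mul]
    refine ENNReal.inv_mul_cancel ?_ (measure_ne_top _ _)
    rw [Measure.measure_univ_ne_zero]
    exact Measure.toSphere_ne_zero _⟩

/-- The pairs of a tuple of points and a direction pointing from the first point into the
convex hull. -/
def tangentPairs (n d : ℕ) [NeZero n] :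
    Set ((Fin n → EuclideanSpace ℝ (Fin d)) × EuclideanSpace ℝ (Fin d)) :=
  {p | ∃ ε : ℝ, 0 < ε ∧ p.1 0 + ε • p.2 ∈ convexHull ℝ (Set.range p.1)}

theorem measurableSet_tangentPairs (n d : ℕ) [NeZero n] : MeasurableSet (tangentPairs n d) := by
  have hC : IsClosed {q : ((Fin n → EuclideanSpace ℝ (Fin d)) × EuclideanSpace ℝ (Fin d)) ×
      (Fin n → ℝ) × ℝ | (0 ≤ q.2.1) ∧ ∑ i, q.2.1 i = 1 ∧
      ∑ i, q.2.1 i • q.1.1 i = q.1.1 0 + exp q.2.2 • q.1.2} :=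
    IsClosed.inter
      ((isClosed_le continuous_const continuous_id).preimage (continuous_fst.comp continuous_snd))
      (IsClosed.inter (isClosed_eq (by fun_prop) (by fun_prop))
        (isClosed_eq (by fun_prop) (by fun_prop)))
  convert hC.measurableSet_image_of_continuous continuous_fst using 1
  ext p
  simp only [tangentPairs, mem_convexHull_range_iff, Set.mem_ofPred_eq, Set.mem_image]
  constructor
  · rintro ⟨ε, hε, t, h0, h1, h2⟩
    exact ⟨(p, t, log ε), ⟨h0, h1, by simpa [exp_log hε] using h2⟩, rfl⟩
  · rintro ⟨⟨_, t, s⟩, ⟨h0, h1, h2⟩, rfl⟩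
    exact ⟨exp s, exp_pos s, t, h0, h1, h2⟩

theorem measure_tangentPairs_eq {n d : ℕ} [NeZero n] (μ : Measure (EuclideanSpace ℝ (Fin d)))
    [SigmaFinite μ]
    (hμ : ∀ L : EuclideanSpace ℝ (Fin d) ≃ₗᵢ[ℝ] EuclideanSpace ℝ (Fin d), MeasurePreserving L μ μ)
    {u v : EuclideanSpace ℝ (Fin d)} (huv : ‖v‖ = ‖u‖) :
    Measure.pi (fun _ : Fin n => μ) {X | (X, u) ∈ tangentPairs n d} =
      Measure.pi (fun _ : Fin n => μ) {X | (X, v) ∈ tangentPairs n d} := by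
  obtain ⟨L, hL⟩ : ∃ L : EuclideanSpace ℝ (Fin d) ≃ₗᵢ[ℝ] EuclideanSpace ℝ (Fin d), L v = u :=
    ⟨_, Submodule.reflection_sub huv⟩
  have hmp := measurePreserving_pi (ι := Fin n) (fun _ => μ) (fun _ => μ) fun _ => hμ L
  have hmeas : MeasurableSet {X | (X, u) ∈ tangentPairs n d} :=
    (measurableSet_tangentPairs n d).preimage (f := fun X => (X, u)) (by fun_prop)
  rw [← hmp.measure_preimage hmeas.nullMeasurableSet]
  congr 1
  ext X
  have hr : (Set.range fun i => L (X i)) = L.toLinearEquiv.toLinearMap '' Set.range X := by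
    rw [← Set.range_comp]
    rfl
  have h (ε : ℝ) : L (X 0) + ε • u ∈ convexHull ℝ (Set.range fun i => L (X i)) ↔
      X 0 + ε • v ∈ convexHull ℝ (Set.range X) := by
    have h1 : L (X 0) + ε • u = L (X 0 + ε • v) := by simp [hL]
    rw [hr, ← LinearMap.image_convexHull, h1]
    exact L.injective.mem_set_image
  simp [tangentPairs, h]

theorem J_one_eq (m : ℕ) (e : EuclideanSpace ℝ (Fin (m + 1))) (he : ‖e‖ = 1) :
    J (m + 2) 1 (-(1 / 2)) = (Measure.pi (fun _ : Fin (m + 2) => betaMeasure (m + 1) (-(1 / 2)))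
      {X | (X, e) ∈ tangentPairs (m + 2) (m + 1)}).toReal := by
  set P := Measure.pi (fun _ : Fin (m + 2) => betaMeasure (m + 1) (-(1 / 2))) with hP
  let T : Set ((Fin (m + 2) → EuclideanSpace ℝ (Fin (m + 1))) ×
      Metric.sphere (0 : EuclideanSpace ℝ (Fin (m + 1))) 1) :=
    {p | (p.1, (p.2 : EuclideanSpace ℝ (Fin (m + 1)))) ∈ tangentPairs (m + 2) (m + 1)}
  have hT : MeasurableSet T := (measurableSet_tangentPairs (m + 2) (m + 1)).preimage
    (f := fun p : (Fin (m + 2) → EuclideanSpace ℝ (Fin (m + 1))) ×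
      Metric.sphere (0 : EuclideanSpace ℝ (Fin (m + 1))) 1 =>
      (p.1, (p.2 : EuclideanSpace ℝ (Fin (m + 1))))) (by fun_prop)
  have h1 : J (m + 2) 1 (-(1 / 2)) = ∫ X, (sphereUnif (m + 1) (Prod.mk X ⁻¹' T)).toReal ∂P := by
    refine integral_congr_ae (Filter.Eventually.of_forall fun X => ?_)
    have hf : (Finset.univ.filter fun i : Fin (m + 2) => (i : ℕ) < 1) = {0} := by
      ext i
      simp only [Finset.mem_filter, Finset.mem_univ, true_and, Finset.mem_singleton, Fin.ext_iff,
        Fin.val_zero]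
      omega
    have hX : ((1 : ℕ) : ℝ)⁻¹ • ∑ i ∈ Finset.univ.filter (fun i : Fin (m + 2) => (i : ℕ) < 1), X i =
        X 0 := by
      rw [hf, Nat.cast_one, inv_one, one_smul, Finset.sum_singleton]
    change internalAngle (m := m + 1) _ _ = _
    rw [hX]
    rfl
  have h2 (u : Metric.sphere (0 : EuclideanSpace ℝ (Fin (m + 1))) 1) :
      P ((fun X => (X, u)) ⁻¹' T) = P {X | (X, e) ∈ tangentPairs (m + 2) (m + 1)} := by
    have hu : ‖e‖ = ‖(u : EuclideanSpace ℝ (Fin (m + 1)))‖ := by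
      rw [he, norm_eq_of_mem_sphere]
    have hpre : (fun X => (X, u)) ⁻¹' T =
        {X | (X, (u : EuclideanSpace ℝ (Fin (m + 1)))) ∈ tangentPairs (m + 2) (m + 1)} := rfl
    rw [hpre]
    exact measure_tangentPairs_eq _ (measurePreserving_betaMeasure _) hu
  rw [h1, integral_toReal (measurable_measure_prodMk_left hT).aemeasurable
    (Filter.Eventually.of_forall fun X => measure_lt_top _ _), ← Measure.prod_apply hT,
    Measure.prod_apply_symm hT]
  simp_rw [h2]
  rw [lintegral_const, measure_univ, mul_one]

theorem two_mul_measure_tangentPairs (m : ℕ) :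
    2 * Measure.pi (fun _ : Fin (m + 2) => betaMeasure (m + 1) (-(1 / 2)))
      {X | (X, EuclideanSpace.single 0 1) ∈ tangentPairs (m + 2) (m + 1)} =
    (ballVol m)⁻¹ ^ (m + 2) * (simplexIntegral m / m.factorial) := by
  set P := Measure.pi (fun _ : Fin (m + 2) => betaMeasure (m + 1) (-(1 / 2))) with hP
  set e : EuclideanSpace ℝ (Fin (m + 1)) := EuclideanSpace.single 0 1 with he
  have ht : Measurable (tailMap m) := (tailMap m).continuous_of_finiteDimensional.measurable
  have hS : MeasurableSet {y : Fin (m + 2) → Fin m → ℝ |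
      y 0 ∈ convexHull ℝ (Set.range fun i : Fin (m + 1) => y i.succ)} :=
    (measurableSet_mem_convexHull_range (E := Fin m → ℝ) (m + 1)).preimage
      (f := fun y : Fin (m + 2) → Fin m → ℝ => (y 0, fun i : Fin (m + 1) => y i.succ)) (by fun_prop)
  have hmp : MeasurePreserving (fun (X : Fin (m + 2) → EuclideanSpace ℝ (Fin (m + 1))) i =>
      tailMap m (X i)) P (Measure.pi fun _ => ballUnif m) :=
    measurePreserving_pi _ _ fun _ => ⟨ht, map_tailMap_betaMeasure m⟩
  have hmeas (u : EuclideanSpace ℝ (Fin (m + 1))) :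
      MeasurableSet {X | (X, u) ∈ tangentPairs (m + 2) (m + 1)} :=
    (measurableSet_tangentPairs (m + 2) (m + 1)).preimage (f := fun X => (X, u)) (by fun_prop)
  have he0 : e ≠ 0 := by simp [he]
  have hae : ∀ᵐ X ∂P, X 0 ∉ convexHull ℝ (Set.range fun i : Fin (m + 1) => X i.succ) := by
    filter_upwards [ae_head_ne_affine_combination (betaMeasure (m + 1) (-(1 / 2)))
      (betaMeasure_absolutelyContinuous _) (k := m + 1) (by simp)] with X hX h
    obtain ⟨t, -, h1, h2⟩ := (mem_convexHull_range_iff _ _).1 h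
    exact hX t h1 h2
  have hneg : P {X | (X, -e) ∈ tangentPairs (m + 2) (m + 1)} =
      P {X | (X, e) ∈ tangentPairs (m + 2) (m + 1)} :=
    measure_tangentPairs_eq _ (measurePreserving_betaMeasure _) (by simp)
  rw [← pi_ballUnif_head_mem_convexHull, ← hmp.measure_preimage hS.nullMeasurableSet, two_mul]
  nth_rewrite 2 [← hneg]
  rw [← measure_union₀ (hmeas _).nullMeasurableSet]
  · refine measure_congr ?_
    filter_upwards [hae] with X hX
    refine propext (exists_add_smul_mem_convexHull_or_iff (tailMap m) he0 ?_ ?_ hX)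
    · ext i
      simp [tailMap_apply, he]
    · intro x hx
      refine ⟨x 0, ?_⟩
      ext i
      refine Fin.cases ?_ (fun j => ?_) i
      · simp [he]
      · simpa [he, tailMap_apply] using congrFun hx j
  · refine measure_mono_null (fun X hX => ?_) (ae_iff.1 hae)
    intro h
    exact not_exists_add_smul_mem_convexHull_and he0 h hX

/-- The volume of the unit ball as a real number. -/
def ballVolReal (m : ℕ) : ℝ := √π ^ m / Gamma ((m : ℝ) / 2 + 1)

theorem ballVolReal_pos (m : ℕ) : 0 < ballVolReal m :=
  div_pos (by positivity) (Gamma_pos_of_pos (by positivity))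

theorem toReal_ballVol (m : ℕ) : (ballVol m).toReal = ballVolReal m := by
  rw [ballVol_eq]
  exact ENNReal.toReal_ofReal (ballVolReal_pos m).le

theorem toReal_simplexIntegral (m : ℕ) :
    (simplexIntegral m).toReal = ballVolReal (m + 1) ^ m *
      (ballVolReal (m * (m + 2)) / ballVolReal (m * (m + 2) + 1)) * (2 / (m + 1)) := by
  have h1 := congrArg ENNReal.toReal (ballVol_pow_eq m)
  have h2 := congrArg ENNReal.toReal (ballVol_succ (m * (m + 2)))
  have h3 := congrArg ENNReal.toReal (ballVol_succ_eq_cauchy m)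
  have hm : (0 : ℝ) < m + 1 := by positivity
  rw [ENNReal.toReal_mul, toReal_ballVol, toReal_ballVol] at h2
  rw [ENNReal.toReal_mul, toReal_ballVol, ENNReal.toReal_ofReal (by positivity)] at h3
  rw [ENNReal.toReal_mul, ENNReal.toReal_mul, ENNReal.toReal_pow, toReal_ballVol] at h1
  have p1 := ballVolReal_pos (m + 1)
  have p2 := ballVolReal_pos (m * (m + 2))
  have p3 := ballVolReal_pos (m * (m + 2) + 1)
  generalize ENNReal.toReal (∫⁻ h in Set.Ioo (-1 : ℝ) 1, _) = A at *
  generalize ENNReal.toReal (∫⁻ c : Fin m → ℝ, _) = B at *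
  have hB : B = ballVolReal (m + 1) * (m + 1) / 2 := by
    rw [h3]
    field_simp
  have hA : A = ballVolReal (m * (m + 2) + 1) / ballVolReal (m * (m + 2)) := by
    rw [h2]
    field_simp
  rw [hA, hB, pow_succ] at h1
  field_simp at h1 ⊢
  linarith

theorem Gamma_half_mul_Gamma_half (m : ℕ) :
    Gamma ((m : ℝ) / 2 + 1) * Gamma (((m + 1 : ℕ) : ℝ) / 2 + 1) =
      (m + 1).factorial * √π / 2 ^ (m + 1) := by
  have h := Gamma_mul_Gamma_add_half ((m : ℝ) / 2 + 1)
  rw [show (m : ℝ) / 2 + 1 + 1 / 2 = ((m + 1 : ℕ) : ℝ) / 2 + 1 by push_cast; ring,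
    show 2 * ((m : ℝ) / 2 + 1) = ((m + 1 : ℕ) : ℝ) + 1 by push_cast; ring, Gamma_nat_eq_factorial,
    show 1 - (((m + 1 : ℕ) : ℝ) + 1) = -((m + 1 : ℕ) : ℝ) by ring, rpow_neg (by norm_num),
    rpow_natCast] at h
  rw [h]
  ring

theorem J_succ_succ_one (m : ℕ) :
    J (m + 2) 1 (-(1 / 2)) = (ballVolReal m)⁻¹ ^ (m + 2) * ((simplexIntegral m).toReal /
      m.factorial) / 2 := by
  have h := congrArg ENNReal.toReal (two_mul_measure_tangentPairs m)
  rw [ENNReal.toReal_mul, ENNReal.toReal_ofNat, ENNReal.toReal_mul, ENNReal.toReal_pow,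
    ENNReal.toReal_inv, toReal_ballVol, ENNReal.toReal_div, ENNReal.toReal_natCast] at h
  rw [J_one_eq m (EuclideanSpace.single 0 1) (by simp), ← h]
  ring

end RandomSimplices

theorem Jb_neg_one_half (n : ℕ) (hn : 2 ≤ n) :
    Jb n 1 (-(1 / 2)) =
      ((n : ℝ) * ((n : ℝ) - 1) ^ 2 /
          (2 ^ n * Real.pi ^ (((n : ℝ) - 2) / 2))) *
        (Real.Gamma ((n : ℝ) / 2) / Real.Gamma (((n : ℝ) + 1) / 2)) ^ (n - 1) *
        (Real.Gamma (((n : ℝ) - 1) ^ 2 / 2) /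
          Real.Gamma ((((n : ℝ) - 1) ^ 2 + 1) / 2)) := by
  obtain ⟨m, rfl⟩ := Nat.exists_eq_add_of_le' hn
  have hN : (0 : ℝ) < (((m + 2 : ℕ) : ℝ) - 1) ^ 2 / 2 := by
    push_cast
    have : (0 : ℝ) < (m : ℝ) + 2 - 1 := by linarith [(Nat.cast_nonneg m : (0 : ℝ) ≤ m)]
    positivity
  have hG := Gamma_half_mul_Gamma_half m
  have hfac : ((m + 1).factorial : ℝ) = (m + 1) * m.factorial := by
    rw [Nat.factorial_succ]
    push_cast
    ring
  rw [hfac] at hG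
  have e1 : ((m + 2 : ℕ) : ℝ) / 2 = (m : ℝ) / 2 + 1 := by push_cast; ring
  have e2 : (((m + 2 : ℕ) : ℝ) + 1) / 2 = ((m + 1 : ℕ) : ℝ) / 2 + 1 := by push_cast; ring
  have e3 : ((((m + 2 : ℕ) : ℝ) - 1) ^ 2 + 1) / 2 = ((m * (m + 2) : ℕ) : ℝ) / 2 + 1 := by
    push_cast; ring
  have e4 : Gamma (((m * (m + 2) + 1 : ℕ) : ℝ) / 2 + 1) =
      (m + 1) ^ 2 / 2 * Gamma ((((m + 2 : ℕ) : ℝ) - 1) ^ 2 / 2) := by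
    rw [show ((m * (m + 2) + 1 : ℕ) : ℝ) / 2 = (((m + 2 : ℕ) : ℝ) - 1) ^ 2 / 2 by push_cast; ring,
      Gamma_add_one hN.ne']
    push_cast
    ring
  have e5 : π ^ ((((m + 2 : ℕ) : ℝ) - 2) / 2) = √π ^ m := by
    rw [rpow_div_two_eq_sqrt _ pi_pos.le, ← rpow_natCast]
    push_cast
    ring_nf
  have g1 : 0 < Gamma ((m : ℝ) / 2 + 1) := Gamma_pos_of_pos (by positivity)
  have g2 : 0 < Gamma (((m + 1 : ℕ) : ℝ) / 2 + 1) := Gamma_pos_of_pos (by positivity)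
  have g3 : 0 < Gamma (((m * (m + 2) : ℕ) : ℝ) / 2 + 1) := Gamma_pos_of_pos (by positivity)
  have g4 := Gamma_pos_of_pos hN
  have hpi : 0 < √π := by positivity
  have hf : (0 : ℝ) < m.factorial := by positivity
  have hm : (0 : ℝ) < (m : ℝ) + 1 := by positivity
  rw [Jb, Nat.choose_one_right, J_succ_succ_one, toReal_simplexIntegral, e1, e2, e3, e5]
  simp only [ballVolReal, e4]
  rw [show m + 2 - 1 = m + 1 from rfl,
    show ((m + 2 : ℕ) : ℝ) - 1 = (m : ℝ) + 1 by push_cast; ring] at *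
  generalize Gamma ((m : ℝ) / 2 + 1) = G1 at *
  generalize Gamma (((m + 1 : ℕ) : ℝ) / 2 + 1) = G2 at *
  generalize Gamma (((m * (m + 2) : ℕ) : ℝ) / 2 + 1) = G3 at *
  generalize Gamma (((m : ℝ) + 1) ^ 2 / 2) = G4 at *
  generalize √π = s at *
  have hG' : G1 * G2 * 2 ^ (m + 1) = (m + 1) * m.factorial * s := by
    rw [hG]
    field_simp
  generalize (m.factorial : ℝ) = f at *
  have hfe : f = G1 * G2 * 2 ^ (m + 1) / ((m + 1) * s) := by
    rw [hG']
    field_simp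
  rw [hfe]
  simp only [div_pow, inv_pow, ← pow_mul]
  field_simp
  ring

end
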